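/- arXiv:2411.14087 — 3 statements merged into one kernel-verified Lean document; each statement's English description precedes it below -/
import Mathlib

section
/- Let F_q be a finite field whose cardinality q satisfies q ≡ 7 (mod 8), and let D ∈ F_q be a nonzero element that is not a square in F_q. Then for every α ∈ F_q with α ≠ 0 there exist x1, x2, x3, y1, y2, y3 ∈ F_q satisfying x1 + x2 + x3 = α, y1 + y2 + y3 = 0, x1² + y1² = D, x2² + y2² = D, and x3² + y3² = D. -/
open Polynomial in
/-- A separable quartic over a finite field with at least seven elements takes a square value. -/
lemma quartic_takes_square {F : Type*} [Field F] [Fintype F] (hF : ringChar F ≠ 2)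
    (hq : 7 ≤ Fintype.card F) (f : F[X]) (hdeg : f.natDegree = 4) (hsep : f.Separable) :
    ∃ s : F, IsSquare (f.eval s) := by
  by_contra hno
  push Not at hno
  set q := Fintype.card F with hqdef
  set m := q / 2 with hm
  have hodd : q % 2 = 1 := FiniteField.odd_card_of_char_ne_two hF
  have hqm : q = 2 * m + 1 := by omega
  have hqF : (q : F) = 0 := FiniteField.cast_card_eq_zero F
  have h2m : (2 * (m : F[X])) = -1 := by
    have h1 : (q : F[X]) = 0 := by
      have := congrArg (C : F →+* F[X]) hqF
      simpa using this
    rw [hqm] at h1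
    push_cast at h1
    linear_combination h1
  set P : F[X] := X ^ q - X with hP
  have hPdeg : P.natDegree = q := FiniteField.X_pow_card_sub_X_natDegree_eq F (by omega)
  have hP0 : P ≠ 0 := FiniteField.X_pow_card_sub_X_ne_zero F (by omega)
  have hP' : derivative P = -1 := by
    have h1 : (q : F[X]) = 0 := by
      have := congrArg (C : F →+* F[X]) hqF
      simpa using this
    simp [hP, derivative_X_pow, hqF]
  have hroots : P.roots = Finset.univ.val := FiniteField.roots_X_pow_card_sub_X F
  have hsplit : P.Splits := by
    rw [splits_iff_card_roots, hroots, hPdeg]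
    rfl
  have heval : ∀ s : F, (f ^ m + 1).eval s = 0 := by
    intro s
    have h0 : f.eval s ≠ 0 := fun h => hno s (h ▸ IsSquare.zero)
    have h1 := FiniteField.pow_dichotomy hF h0
    have h2 := (FiniteField.isSquare_iff hF h0).not.mp (hno s)
    rcases h1 with h1 | h1
    · exact absurd h1 h2
    · simp only [eval_add, eval_pow, eval_one]
      rw [h1]; ring
  have hdvd : P ∣ f ^ m + 1 := by
    by_cases hz : f ^ m + 1 = 0
    · rw [hz]; exact dvd_zero _
    · apply hsplit.dvd_of_roots_le_roots hP0
      rw [hroots, Multiset.le_iff_subset Finset.univ.nodup]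
      intro s _
      rw [mem_roots hz]
      exact heval s
  obtain ⟨h, hh⟩ := hdvd
  have hhdeg : h.natDegree ≤ q - 2 := by
    by_cases hz : h = 0
    · simp [hz]
    · have h1 := natDegree_mul hP0 hz
      rw [← hh, hPdeg] at h1
      have h2 : (f ^ m + 1).natDegree ≤ 4 * m := by
        compute_degree
        rw [hdeg]; omega
      omega
  have hd1 : derivative (f ^ m) * (2 * f) = - derivative f * f ^ m := by
    obtain ⟨n, hn⟩ : ∃ n, m = n + 1 := ⟨m - 1, by omega⟩
    rw [derivative_pow]
    simp only [map_natCast]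
    have : f ^ m = f ^ (m - 1) * f := by
      rw [← pow_succ]; congr 1; omega
    rw [this]
    linear_combination (f ^ (m - 1) * f * derivative f) * h2m
  have hd2 : derivative (f ^ m) = -h + P * derivative h := by
    have := congrArg derivative hh
    simp only [derivative_add, derivative_one, derivative_mul, hP'] at this
    linear_combination this
  set k : F[X] := 2 * f * derivative h + derivative f * h with hk
  have e1 : P * k = 2 * f * h + derivative f := by
    rw [hd2] at hd1
    rw [hk]
    linear_combination hd1 - derivative f * hh
  have e2 : derivative f * h = P * derivative k - 2 * k - derivative (derivative f) := by
    have := congrArg derivative e1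
    simp only [derivative_add, derivative_mul, hP', derivative_ofNat] at this
    linear_combination - this - hk
  have e3 : P * (derivative f * k - 2 * f * derivative k)
      = derivative f ^ 2 - 4 * f * k - 2 * f * derivative (derivative f) := by
    linear_combination (derivative f) * e1 + 2 * f * e2
  have hf'deg : (derivative f).natDegree ≤ 3 := by
    have := natDegree_derivative_le f; omega
  have hf''deg : (derivative (derivative f)).natDegree ≤ 2 := by
    have := natDegree_derivative_le (derivative f); omega
  have hkdeg : k.natDegree ≤ 2 := by
    by_cases hz : k = 0
    · simp [hz]
    · have h1 := natDegree_mul hP0 hz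
      rw [e1, hPdeg] at h1
      have h2 : (2 * f * h + derivative f).natDegree ≤ q + 2 := by
        apply natDegree_add_le_of_degree_le
        · have a1 := natDegree_mul_le (p := 2 * f) (q := h)
          have a2 := natDegree_mul_le (p := (2 : F[X])) (q := f)
          have a3 : (2 : F[X]).natDegree = 0 := natDegree_ofNat 2
          omega
        · omega
      omega
  have e4 : derivative f * k - 2 * f * derivative k = 0 := by
    by_contra hz
    have h1 := natDegree_mul hP0 hz
    rw [e3, hPdeg] at h1
    have h2 : (derivative f ^ 2 - 4 * f * k - 2 * f * derivative (derivative f)).natDegree ≤ 6 := by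
      have a2 := natDegree_mul_le (p := (2 : F[X])) (q := f)
      have a3 : (2 : F[X]).natDegree = 0 := natDegree_ofNat 2
      have b2 := natDegree_mul_le (p := (4 : F[X])) (q := f)
      have b3 : (4 : F[X]).natDegree = 0 := natDegree_ofNat 4
      have a4 := natDegree_mul_le (p := 2 * f) (q := derivative (derivative f))
      have b4 := natDegree_mul_le (p := 4 * f) (q := k)
      have c := natDegree_pow_le (p := derivative f) (n := 2)
      have d1 := natDegree_sub_le (derivative f ^ 2) (4 * f * k)
      have d2 := natDegree_sub_le (derivative f ^ 2 - 4 * f * k) (2 * f * derivative (derivative f))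
      rw [le_max_iff] at d1 d2
      omega
    omega
  rw [e4, mul_zero] at e3
  have hfk : f ∣ k := by
    apply (separable_def f).mp hsep |>.dvd_of_dvd_mul_left
    exact ⟨2 * derivative k, by linear_combination e4⟩
  have hk0 : k = 0 := by
    by_contra hz
    have := natDegree_le_of_dvd hfk hz
    omega
  have hff : f ∣ derivative f * derivative f :=
    ⟨4 * k + 2 * derivative (derivative f), by linear_combination -e3⟩
  have hff' : f ∣ derivative f := ((separable_def f).mp hsep).dvd_of_dvd_mul_left hff
  have hu : IsUnit f := ((separable_def f).mp hsep).isUnit_of_dvd' dvd_rfl hff'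
  have := natDegree_eq_zero_of_isUnit hu
  omega

/-- From a point on the circle with `N (4 D - N)` a square, build the solution. -/
lemma solution_of_square {F : Type*} [Field F] (h2 : (2 : F) ≠ 0) (D α x y t : F)
    (hxy : x ^ 2 + y ^ 2 = D) (hN : α ^ 2 + D - 2 * α * x ≠ 0)
    (ht : (α ^ 2 + D - 2 * α * x) * (4 * D - (α ^ 2 + D - 2 * α * x)) = t ^ 2) :
      ∃ x1 x2 x3 y1 y2 y3 : F,
        x1 + x2 + x3 = α ∧ y1 + y2 + y3 = 0 ∧
        x1 ^ 2 + y1 ^ 2 = D ∧ x2 ^ 2 + y2 ^ 2 = D ∧ x3 ^ 2 + y3 ^ 2 = D := by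
  set N := α ^ 2 + D - 2 * α * x with hNdef
  have hw : (α - x) ^ 2 + y ^ 2 = N := by rw [hNdef]; linear_combination hxy
  refine ⟨((α - x) * N + y * t) / (2 * N), ((α - x) * N - y * t) / (2 * N), x,
    (-y * N + (α - x) * t) / (2 * N), (-y * N - (α - x) * t) / (2 * N), y, ?_, ?_, ?_, ?_, hxy⟩
  · field_simp; ring
  · field_simp; ring
  · rw [div_pow, div_pow, ← add_div, div_eq_iff (by positivity)]
    linear_combination (N ^ 2 + t ^ 2) * hw - N * ht
  · rw [div_pow, div_pow, ← add_div, div_eq_iff (by positivity)]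
    linear_combination (N ^ 2 + t ^ 2) * hw - N * ht

open Polynomial in
lemma exists_sq_add_sq {F : Type*} [Field F] [Fintype F] (hodd : Fintype.card F % 2 = 1)
    (D : F) : ∃ a b : F, a ^ 2 + b ^ 2 = D := by
  obtain ⟨a, b, hab⟩ := FiniteField.exists_root_sum_quadratic (f := (X ^ 2 : F[X]))
    (g := X ^ 2 - C D) (by simp) (degree_X_pow_sub_C (by norm_num) _) hodd
  refine ⟨a, b, ?_⟩
  simp at hab
  linear_combination hab

open Polynomial in
/-- Let `F` be a finite field with `card F ≡ 7 (mod 8)` and `D` a nonzero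
non-square of `F`. Then for every nonzero `α ∈ F` the system
`x1+x2+x3 = α`, `y1+y2+y3 = 0`, `xi² + yi² = D` is solvable. -/
theorem system_odd_solvable (F : Type*) [Field F] [Fintype F]
    (h7 : Fintype.card F % 8 = 7) (D : F) (hD0 : D ≠ 0)
    (hDns : ¬ ∃ w : F, D = w ^ 2) :
    ∀ α : F, α ≠ 0 →
      ∃ x1 x2 x3 y1 y2 y3 : F,
        x1 + x2 + x3 = α ∧ y1 + y2 + y3 = 0 ∧
        x1 ^ 2 + y1 ^ 2 = D ∧ x2 ^ 2 + y2 ^ 2 = D ∧ x3 ^ 2 + y3 ^ 2 = D := by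
  intro α hα
  have hchar : ringChar F ≠ 2 := by
    intro h
    have := FiniteField.even_card_of_char_two h
    omega
  have h2 : (2 : F) ≠ 0 := Ring.two_ne_zero hchar
  have h4 : (4 : F) ≠ 0 := by
    have : (4 : F) = 2 * 2 := by norm_num
    rw [this]; exact mul_ne_zero h2 h2
  have hneg : ∀ a b : F, a ^ 2 + b ^ 2 = 0 → b = 0 := by
    intro a b hab
    by_contra hb
    have : IsSquare (-1 : F) := ⟨a / b, by field_simp; linear_combination -hab⟩
    rw [FiniteField.isSquare_neg_one_iff] at this
    omega
  have hNne : ∀ x y : F, x ^ 2 + y ^ 2 = D → α ^ 2 + D - 2 * α * x ≠ 0 := by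
    intro x y hxy h0
    have hy := hneg (α - x) y (by linear_combination h0 + hxy)
    exact hDns ⟨x, by rw [← hxy, hy]; ring⟩
  by_contra hcon
  have key : ∀ x y : F, x ^ 2 + y ^ 2 = D →
      ¬ IsSquare ((α ^ 2 + D - 2 * α * x) * (4 * D - (α ^ 2 + D - 2 * α * x))) := by
    rintro x y hxy ⟨t, ht⟩
    exact hcon (solution_of_square h2 D α x y t hxy (hNne x y hxy) (by rw [ht]; ring))
  have hMne : ∀ x y : F, x ^ 2 + y ^ 2 = D → 4 * D - (α ^ 2 + D - 2 * α * x) ≠ 0 := by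
    intro x y hxy h0
    apply key x y hxy
    rw [h0, mul_zero]
    exact IsSquare.zero
  obtain ⟨a, b, hab⟩ := exists_sq_add_sq (by omega) D
  have hs : ∀ s : F, 1 + s ^ 2 ≠ 0 := by
    intro s h
    exact one_ne_zero (hneg s 1 (by linear_combination h))
  -- parametrisation of the circle
  have hpar : ∀ s : F, ((a * (1 - s ^ 2) - 2 * b * s) / (1 + s ^ 2)) ^ 2 +
      ((2 * a * s + b * (1 - s ^ 2)) / (1 + s ^ 2)) ^ 2 = D := by
    intro s
    have := hs s
    rw [div_pow, div_pow, ← add_div, div_eq_iff (pow_ne_zero 2 this)]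
    linear_combination (1 + s ^ 2) ^ 2 * hab
  set A := α ^ 2 + D with hA
  set p1 : F[X] := C (A + 2 * α * a) * X ^ 2 + C (4 * α * b) * X + C (A - 2 * α * a) with hp1
  set p2 : F[X] := C (4 * D - (A + 2 * α * a)) * X ^ 2 + C (-(4 * α * b)) * X
    + C (4 * D - (A - 2 * α * a)) with hp2
  have hl1 : A + 2 * α * a ≠ 0 := by
    have := hNne (-a) b (by linear_combination hab)
    intro h; apply this; linear_combination h
  have hl2 : 4 * D - (A + 2 * α * a) ≠ 0 := by
    have := hMne (-a) b (by linear_combination hab)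
    intro h; apply this; linear_combination h
  have hd1 : p1.natDegree = 2 := natDegree_quadratic hl1
  have hd2 : p2.natDegree = 2 := natDegree_quadratic hl2
  have hev1 : ∀ s : F, p1.eval s = (1 + s ^ 2) *
      (A - 2 * α * ((a * (1 - s ^ 2) - 2 * b * s) / (1 + s ^ 2))) := by
    intro s
    have := hs s
    simp only [hp1, eval_add, eval_mul, eval_C, eval_pow, eval_X]
    field_simp
    ring
  have hev2 : ∀ s : F, p2.eval s = (1 + s ^ 2) *
      (4 * D - (A - 2 * α * ((a * (1 - s ^ 2) - 2 * b * s) / (1 + s ^ 2)))) := by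
    intro s
    have := hs s
    simp only [hp2, eval_add, eval_mul, eval_C, eval_pow, eval_X]
    field_simp
    ring
  have hi1 : Irreducible p1 := by
    apply irreducible_of_degree_le_three_of_not_isRoot (by simp [hd1])
    intro s h
    rw [IsRoot.def, hev1] at h
    exact mul_ne_zero (hs s) (hNne _ _ (hpar s)) h
  have hi2 : Irreducible p2 := by
    apply irreducible_of_degree_le_three_of_not_isRoot (by simp [hd2])
    intro s h
    rw [IsRoot.def, hev2] at h
    exact mul_ne_zero (hs s) (hMne _ _ (hpar s)) h
  have hcop : IsCoprime p1 p2 := by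
    rw [hi1.coprime_iff_not_dvd]
    rintro ⟨c, hc⟩
    have hp20 : p2 ≠ 0 := hi2.ne_zero
    have hc0 : c ≠ 0 := by rintro rfl; simp at hc; exact hp20 hc
    have hcd := natDegree_mul hi1.ne_zero hc0
    rw [← hc, hd1, hd2] at hcd
    obtain ⟨r, rfl⟩ := natDegree_eq_zero.mp (show c.natDegree = 0 by omega)
    have c0 := congrArg (fun p => coeff p 0) hc
    have c1 := congrArg (fun p => coeff p 1) hc
    have c2 := congrArg (fun p => coeff p 2) hc
    simp only [coeff_mul_C, hp1, hp2, coeff_add, coeff_C_mul, coeff_X_pow, coeff_X, coeff_C] at c0 c1 c2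
    norm_num at c0 c1 c2
    have hr : 1 + r ≠ 0 := by
      intro h
      apply mul_ne_zero h4 hD0
      linear_combination c0 + (A - 2 * α * a) * h
    have hb : b = 0 := by
      have : (4 * α * (1 + r)) * b = 0 := by linear_combination -c1
      exact (mul_eq_zero.mp this).resolve_left (mul_ne_zero (mul_ne_zero h4 hα) hr)
    have ha : a = 0 := by
      have : (4 * α * (1 + r)) * a = 0 := by linear_combination c0 - c2
      exact (mul_eq_zero.mp this).resolve_left (mul_ne_zero (mul_ne_zero h4 hα) hr)
    apply hD0
    rw [← hab, ha, hb]; ring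
  have hsep : (p1 * p2).Separable :=
    (PerfectField.separable_of_irreducible hi1).mul
      (PerfectField.separable_of_irreducible hi2) hcop
  obtain ⟨s, t, ht⟩ := quartic_takes_square hchar (by omega) (p1 * p2)
    (by rw [natDegree_mul hi1.ne_zero hi2.ne_zero, hd1, hd2]) hsep
  apply key _ _ (hpar s)
  rw [eval_mul, hev1, hev2] at ht
  have := hs s
  refine ⟨t / (1 + s ^ 2), ?_⟩
  rw [div_mul_div_comm, ← ht, eq_div_iff (mul_ne_zero this this)]
  ring
end

section
/- Assume the standard setup, and let ℓ ≥ 3 be an integer with q ≡ 2^ℓ − 1 (mod 2^{ℓ+1}). Let L be the unique subfield of F with q elements (so K ⊆ L ⊆ F), let m = (q0−1)/2, and let H_m be the unique subgroup of Fˣ of order m(q+1). Then the following are equivalent: (a) there exists γ ∈ Fˣ with (γ^{q−1})^{2^ℓ} = 1 and (γ^{q−1})^{2^{ℓ−1}} ≠ 1 such that γ (as an element of F) cannot be written as h1 + h2 with h1, h2 ∈ H_m; (b) there exists x ∈ L with x ≠ 0 such that for every nonzero non-square β of K, the element x² − β of L is a nonzero square in L. -/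
lemma npi_mem_iff {F : Type*} [Field F] [Fintype F] (S : Subfield F) (n : ℕ)
    (hS : Nat.card S = n) (hn : 1 < n) (a : F) : a ∈ S ↔ a ^ n = a := by
  classical
  haveI : Fintype S := Fintype.ofFinite S
  have hpow : ∀ b : F, b ∈ S → b ^ n = b := by
    intro b hb
    have h := FiniteField.pow_card (⟨b, hb⟩ : S)
    rw [← Nat.card_eq_fintype_card, hS] at h
    exact congrArg Subtype.val h
  refine ⟨hpow a, fun ha => ?_⟩
  let P : Polynomial F := Polynomial.X ^ n - Polynomial.X
  have hP : P ≠ 0 := FiniteField.X_pow_card_sub_X_ne_zero F hn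
  have hdeg : P.natDegree = n := FiniteField.X_pow_card_sub_X_natDegree_eq F hn
  have hmem : ∀ b : F, b ∈ P.roots.toFinset ↔ b ^ n = b := by
    intro b
    simp [Polynomial.mem_roots hP, P, sub_eq_zero]
  let T : Finset F := Finset.univ.filter (fun b => b ∈ S)
  have hTc : T.card = n := by
    rw [← hS, Nat.card_eq_fintype_card, Fintype.card_subtype]
  have hsub : T ⊆ P.roots.toFinset := by
    intro b hb
    rw [hmem]
    exact hpow b (by simpa [T] using hb)
  have heq : T = P.roots.toFinset := by
    apply Finset.eq_of_subset_of_card_le hsub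
    rw [hTc]
    calc P.roots.toFinset.card ≤ P.roots.card := Multiset.toFinset_card_le _
      _ ≤ P.natDegree := Polynomial.card_roots' _
      _ = n := hdeg
  have : a ∈ T := by rw [heq, hmem]; exact ha
  simpa [T] using this

lemma npi_mem_sub {F : Type*} [Field F] [Fintype F] (H : Subgroup Fˣ) (n : ℕ)
    (hH : Nat.card H = n) (h : Fˣ) : h ∈ H ↔ (h : F) ^ n = 1 := by
  have hn : n ≠ 0 := by rw [← hH]; exact Nat.card_pos.ne'
  haveI : NeZero n := ⟨hn⟩
  have hle : H ≤ rootsOfUnity n F := by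
    intro g hg
    rw [mem_rootsOfUnity]
    have := pow_card_eq_one' (x := (⟨g, hg⟩ : H))
    rw [hH] at this
    exact congrArg Subtype.val this
  have heq : H = rootsOfUnity n F := by
    apply Subgroup.eq_of_le_of_card_ge hle
    rw [hH]
    exact card_rootsOfUnity F n
  rw [heq, mem_rootsOfUnity']

lemma npi_frob {F : Type*} [Field F] [Fintype F] (q : ℕ)
    (hF : Fintype.card F = q ^ 2) (a b : F) : (a + b) ^ q = a ^ q + b ^ q := by
  obtain ⟨n, hp, hc⟩ := FiniteField.card F (ringChar F)
  haveI : Fact (ringChar F).Prime := ⟨hp⟩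
  have hd : q ∣ ringChar F ^ (n : ℕ) := by
    rw [← hc, hF]; exact Dvd.intro_left _ (pow_two q).symm
  obtain ⟨k, -, hk⟩ := (Nat.dvd_prime_pow hp).1 hd
  rw [hk]
  exact add_pow_char_pow a b (ringChar F) k

lemma npi_sq {F : Type*} [Field F] (a : F) : a ^ 2 = 1 ↔ a = 1 ∨ a = -1 := by
  simp

/-- Standard setup, `ℓ ≥ 3`, `q ≡ 2^ℓ − 1 (mod 2^(ℓ+1))`. Property NPi for an
odd index holds iff there exists nonzero `x ∈ L` such that `x² − β` is a
nonzero square in `L` for every nonzero non-square `β` of `K`. -/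
theorem propertyNPi_odd_iff (q0 s q ℓ : ℕ) (hq0 : IsPrimePow q0)
    (hq0odd : Odd q0) (hs : Odd s) (hq : q = q0 ^ s) (hℓ : 3 ≤ ℓ)
    (hqmod : q ≡ 2 ^ ℓ - 1 [MOD 2 ^ (ℓ + 1)])
    (F : Type*) [Field F] [Fintype F] (hF : Fintype.card F = q ^ 2)
    (K : Subfield F) (hK : Nat.card K = q0)
    (L : Subfield F) (hL : Nat.card L = q) (hKL : K ≤ L)
    (m : ℕ) (hm : m = (q0 - 1) / 2)
    (Hm : Subgroup Fˣ) (hHm : Nat.card Hm = m * (q + 1)) :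
    (∃ γ : Fˣ, (γ ^ (q - 1)) ^ 2 ^ ℓ = 1 ∧ (γ ^ (q - 1)) ^ 2 ^ (ℓ - 1) ≠ 1 ∧
        ∀ h1 h2 : Fˣ, h1 ∈ Hm → h2 ∈ Hm → (γ : F) ≠ (h1 : F) + (h2 : F)) ↔
      (∃ x : F, x ∈ L ∧ x ≠ 0 ∧
        ∀ β : F, β ∈ K → β ≠ 0 → (¬ ∃ w ∈ K, β = w ^ 2) →
          (x ^ 2 - β ≠ 0 ∧ ∃ w ∈ L, x ^ 2 - β = w ^ 2)) := by
  classical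
  -- arithmetic
  obtain ⟨t, ht⟩ : ∃ t, q + 1 = 2 ^ ℓ * (2 * t + 1) := by
    have h1 : 1 ≤ 2 ^ ℓ := Nat.one_le_two_pow
    have h2 : q % 2 ^ (ℓ + 1) = 2 ^ ℓ - 1 := by
      have h3 : q % 2 ^ (ℓ + 1) = (2 ^ ℓ - 1) % 2 ^ (ℓ + 1) := hqmod
      rw [h3]
      apply Nat.mod_eq_of_lt
      rw [pow_succ]; omega
    have h4 := Nat.div_add_mod q (2 ^ (ℓ + 1))
    rw [h2] at h4
    refine ⟨q / 2 ^ (ℓ + 1), ?_⟩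
    have h5 : 2 ^ (ℓ + 1) * (q / 2 ^ (ℓ + 1)) = 2 ^ ℓ * (2 * (q / 2 ^ (ℓ + 1))) := by
      rw [pow_succ]; ring
    rw [h5] at h4
    rw [mul_add, mul_one]; omega
  obtain ⟨A, hA⟩ : ∃ A, q + 1 = 8 * A := by
    refine ⟨2 ^ (ℓ - 3) * (2 * t + 1), ?_⟩
    rw [ht]
    obtain ⟨k, rfl⟩ := Nat.exists_eq_add_of_le hℓ
    rw [Nat.add_sub_cancel_left, pow_add]; ring
  obtain ⟨j, hj⟩ : ∃ j, q = 2 * (2 * j + 1) + 1 := ⟨2 * A - 1, by omega⟩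
  have hq04 : q0 % 4 = 3 := by
    by_contra h
    have h1 : q0 % 4 = 1 := by
      obtain ⟨k, hk⟩ := hq0odd; omega
    have h2 : q % 4 = 1 := by
      rw [hq, Nat.pow_mod, h1]; simp
    omega
  obtain ⟨i, hi⟩ : ∃ i, m = 2 * i + 1 := ⟨q0 / 4, by omega⟩
  have hq0m : q0 = 2 * m + 1 := by omega
  have hq1 : 1 < q := by omega
  have hq01 : 1 < q0 := by omega
  have hLm := npi_mem_iff L q hL hq1
  have hKm := npi_mem_iff K q0 hK hq01
  have hHmm := npi_mem_sub Hm _ hHm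
  have frob := npi_frob q hF
  have hcar : ∀ a : F, (a ^ q) ^ q = a := by
    intro a
    rw [← pow_mul, ← pow_two, ← hF]; exact FiniteField.pow_card a
  have hchar : ringChar F ≠ 2 := by
    intro h
    have h1 := FiniteField.even_card_iff_char_two.1 h
    rw [hF] at h1
    have h2 : Odd (q ^ 2) := Odd.pow ⟨2 * j + 1, hj⟩
    rw [Nat.odd_iff] at h2; omega
  have h2F : (2 : F) ≠ 0 := Ring.two_ne_zero hchar
  have hqodd : Odd q := ⟨2 * j + 1, hj⟩
  have hdiv : Fintype.card F / 2 = (2 * j + 1) * (q + 1) := by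
    rw [hF]
    have : q ^ 2 = 2 * ((2 * j + 1) * (q + 1)) + 1 := by rw [hj]; ring
    omega
  have hpowq : ∀ a : F, a ≠ 0 → a ∈ L → a ^ (2 * (2 * j + 1)) = 1 := by
    intro a ha haL
    have h1 := (hLm a).1 haL
    rw [hj, pow_succ] at h1
    exact mul_right_cancel₀ ha (by rw [h1, one_mul])
  have hneg1 : (-1 : F) ≠ 1 := by
    intro h
    apply h2F
    linear_combination -h
  -- `-1` is not a square in `L`
  have hnsq : ∀ a b : F, a ∈ L → b ∈ L → a ^ 2 + b ^ 2 = 0 → a = 0 := by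
    intro a b ha hb hab
    by_contra ha0
    have hb0 : b ≠ 0 := by
      rintro rfl
      apply ha0
      simpa using hab
    have h1 := hpowq a ha0 ha
    have h2 := hpowq b hb0 hb
    rw [pow_mul, show a ^ 2 = - b ^ 2 by linear_combination hab,
      Odd.neg_pow ⟨j, rfl⟩, ← pow_mul, h2] at h1
    exact hneg1 h1
  have hsub : q - 1 = 2 * (2 * j + 1) := by omega
  constructor
  · rintro ⟨γ, hγ1, hγ2, hγ⟩
    have hg0 : (γ : F) ≠ 0 := γ.ne_zero
    have hz : (((γ : F) ^ (q - 1)) ^ 2 ^ (ℓ - 1)) = -1 := by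
      have h1 : ((((γ : F) ^ (q - 1)) ^ 2 ^ (ℓ - 1))) ^ 2 = 1 := by
        rw [← pow_mul _ (2 ^ (ℓ - 1)), ← pow_succ, show ℓ - 1 + 1 = ℓ by omega]
        have h2 := congrArg Units.val hγ1
        push_cast at h2
        exact h2
      rcases (npi_sq _).1 h1 with h | h
      · exact absurd (Units.ext (by push_cast; exact h)) hγ2
      · exact h
    set n : F := (γ : F) ^ (q + 1) with hn
    have hn0 : n ≠ 0 := pow_ne_zero _ hg0
    have hnL : n ∈ L := by
      rw [hLm, hn, pow_succ, mul_pow, hcar, mul_comm]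
    have hnj : n ^ (2 * j + 1) = -1 := by
      have h1 : (q + 1) * (2 * j + 1) = (q - 1) * 2 ^ (ℓ - 1) * (2 * t + 1) := by
        rw [ht, hsub]
        have : 2 ^ ℓ = 2 * 2 ^ (ℓ - 1) := by rw [← pow_succ']; congr 1; omega
        rw [this]; ring
      rw [hn, ← pow_mul, h1, pow_mul, pow_mul, hz]
      exact Odd.neg_one_pow ⟨t, rfl⟩
    have hy : ∃ y ∈ L, n = - y ^ 2 := by
      refine ⟨(-n) ^ (j + 1), L.pow_mem (L.neg_mem hnL) _, ?_⟩
      rw [← pow_mul, show (j + 1) * 2 = (2 * j + 1) + 1 by ring, pow_succ,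
        Odd.neg_pow ⟨j, rfl⟩, hnj]
      ring
    obtain ⟨y, hyL, hy⟩ := hy
    have hy0 : y ≠ 0 := by
      rintro rfl
      apply hn0; rw [hy]; ring
    refine ⟨y, hyL, hy0, ?_⟩
    intro β hβK hβ0 hβ
    -- `-β` is a square in `K`
    have hw : ∃ w ∈ K, β = - w ^ 2 := by
      have hb2 : (β ^ m) ^ 2 = 1 := by
        rw [← pow_mul, mul_comm m 2]
        have h1 := (hKm β).1 hβK
        rw [hq0m, pow_succ] at h1
        exact mul_right_cancel₀ hβ0 (by rw [h1, one_mul])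
      rcases (npi_sq _).1 hb2 with h | h
      · exfalso
        apply hβ
        refine ⟨β ^ (i + 1), K.pow_mem hβK _, ?_⟩
        rw [← pow_mul, show (i + 1) * 2 = m + 1 by omega, pow_succ, h, one_mul]
      · refine ⟨β ^ (i + 1), K.pow_mem hβK _, ?_⟩
        rw [← pow_mul, show (i + 1) * 2 = m + 1 by omega, pow_succ, h]
        ring
    obtain ⟨w, hwK, rfl⟩ := hw
    have hw0 : w ≠ 0 := by
      rintro rfl
      apply hβ0; ring
    have hwL := hKL hwK
    have hne : y ^ 2 - -w ^ 2 ≠ 0 := by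
      intro h
      exact hy0 (hnsq y w hyL hwL (by linear_combination h))
    refine ⟨hne, ?_⟩
    have hzL : y ^ 2 - -w ^ 2 ∈ L := L.sub_mem (L.pow_mem hyL _) (L.neg_mem (L.pow_mem hwL _))
    have hsq : IsSquare (y ^ 2 - -w ^ 2) := by
      rw [FiniteField.isSquare_iff hchar hne, hdiv]
      have : (2 * j + 1) * (q + 1) = (2 * (2 * j + 1)) * (4 * A) := by rw [hA]; ring
      rw [this, pow_mul, hpowq _ hne hzL, one_pow]
    obtain ⟨d, hd⟩ := hsq
    refine ⟨d, ?_, by rw [hd]; ring⟩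
    by_contra hdL
    have hdq : d ^ q = -d := by
      have h1 := (hLm _).1 hzL
      rw [hd, mul_pow] at h1
      rcases mul_self_eq_mul_self_iff.1 h1 with h | h
      · exact absurd ((hLm d).2 h) hdL
      · exact h
    have hyq := (hLm y).1 hyL
    have h2q : (2 : F) ^ q = 2 := by
      rw [← one_add_one_eq_two, frob]; simp
    -- the two summands
    have key : ∀ e : F, e ^ q = -e → e ^ 2 = 1 + w ^ 2 / y ^ 2 →
        ∃ h : Fˣ, h ∈ Hm ∧ (h : F) = γ * (1 + e) / 2 := by
      intro e he he2
      have hN : ((γ : F) * (1 + e) / 2) ^ (q + 1) = (w / 2) ^ 2 := by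
        have h1 : ((γ : F) * (1 + e) / 2) ^ (q + 1) = n * (1 - e ^ 2) / 4 := by
          rw [div_pow, mul_pow, ← hn, pow_succ (1 + e), pow_succ (2 : F), frob, h2q, he, one_pow]
          ring
        have h4F : (4 : F) ≠ 0 := by
          rw [show (4 : F) = 2 * 2 by norm_num]; exact mul_ne_zero h2F h2F
        rw [h1, he2, hy, div_pow, show (2 : F) ^ 2 = 4 by norm_num]
        congr 1
        field_simp
        ring
      have hu0 : (w / 2) ^ 2 ≠ 0 := pow_ne_zero _ (div_ne_zero hw0 h2F)
      have hne0 : (γ : F) * (1 + e) / 2 ≠ 0 := by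
        intro h0
        rw [h0, zero_pow (by omega)] at hN
        exact hu0 hN.symm
      refine ⟨Units.mk0 _ hne0, ?_, rfl⟩
      rw [hHmm, Units.val_mk0, mul_comm m, pow_mul, hN, ← pow_mul]
      have hwK2 : w / 2 ∈ K := K.div_mem hwK (by exact_mod_cast natCast_mem K 2)
      have h1 := (hKm _).1 hwK2
      rw [hq0m, pow_succ] at h1
      exact mul_right_cancel₀ (div_ne_zero hw0 h2F) (by rw [h1, one_mul])
    have he2 : (d / y) ^ 2 = 1 + w ^ 2 / y ^ 2 := by
      rw [div_pow, pow_two d, ← hd]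
      field_simp
      ring
    obtain ⟨h1, h1m, h1e⟩ := key (d / y) (by rw [div_pow, hdq, hyq]; ring) he2
    obtain ⟨h2, h2m, h2e⟩ := key (-(d / y))
      (by rw [Odd.neg_pow hqodd, div_pow, hdq, hyq]; ring) (by rw [neg_sq, he2])
    apply hγ h1 h2 h1m h2m
    rw [h1e, h2e]
    field_simp
    ring
  · rintro ⟨x, hxL, hx0, hx⟩
    obtain ⟨g, hg⟩ := FiniteField.exists_nonsquare (F := F) hchar
    have hg0 : g ≠ 0 := by
      rintro rfl
      exact hg ⟨0, by simp⟩
    have hgp : g ^ ((2 * j + 1) * (q + 1)) = -1 := by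
      rw [← hdiv]
      rcases FiniteField.pow_dichotomy hchar hg0 with h | h
      · exact absurd ((FiniteField.isSquare_iff hchar hg0).2 h) hg
      · exact h
    set θ : F := g ^ ((2 * t + 1) * (2 * j + 1)) with hθ
    have hθ0 : θ ≠ 0 := pow_ne_zero _ hg0
    have hθl : θ ^ 2 ^ ℓ = -1 := by
      rw [hθ, ← pow_mul, ← hgp, ht]
      congr 1; ring
    have hxp := hpowq x hx0 hxL
    have hγq : (θ * x) ^ (q - 1) = θ ^ (2 * (2 * j + 1)) := by
      rw [hsub, mul_pow, hxp, mul_one]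
    have hxq := (hLm x).1 hxL
    have hnorm : (θ * x) ^ (q + 1) = - x ^ 2 := by
      rw [mul_pow, pow_succ x, hxq, ht, pow_mul, hθl, Odd.neg_one_pow ⟨t, rfl⟩]; ring
    refine ⟨Units.mk0 (θ * x) (mul_ne_zero hθ0 hx0), ?_, ?_, ?_⟩
    · apply Units.ext
      push_cast
      rw [Units.val_mk0, hγq, ← pow_mul, mul_comm, pow_mul, hθl, pow_mul]
      simp
    · intro h
      have h := congrArg Units.val h
      push_cast at h
      rw [Units.val_mk0, hγq, ← pow_mul,
        show 2 * (2 * j + 1) * 2 ^ (ℓ - 1) = 2 ^ ℓ * (2 * j + 1) by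
          have : 2 ^ ℓ = 2 * 2 ^ (ℓ - 1) := by rw [← pow_succ']; congr 1; omega
          rw [this]; ring, pow_mul, hθl, Odd.neg_one_pow ⟨j, rfl⟩] at h
      exact hneg1 h
    · intro h1 h2 h1m h2m hsum
      rw [Units.val_mk0] at hsum
      have hsq : ∀ h : Fˣ, h ∈ Hm → ∃ u ∈ K, (h : F) ^ q * h = u ^ 2 := by
        intro h hh
        rw [hHmm, mul_comm, pow_mul] at hh
        have haK : (h : F) ^ (q + 1) ∈ K := by
          rw [hKm, hq0m, pow_succ _ (2 * m), mul_comm 2 m, pow_mul, hh]; simp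
        refine ⟨((h : F) ^ (q + 1)) ^ (i + 1), K.pow_mem haK _, ?_⟩
        rw [← pow_mul _ (i + 1), show (i + 1) * 2 = m + 1 by omega, pow_succ _ m, hh, one_mul,
          pow_succ]
      obtain ⟨u, huK, hu⟩ := hsq h1 h1m
      obtain ⟨v, hvK, hv⟩ := hsq h2 h2m
      have hx' : ∀ w ∈ K, ∃ z ∈ L, z ≠ 0 ∧ x ^ 2 + w ^ 2 = z ^ 2 := by
        intro w hw
        by_cases hw0 : w = 0
        · exact ⟨x, hxL, hx0, by rw [hw0]; ring⟩
        · obtain ⟨hne, z, hzL, hz⟩ := hx (-w ^ 2) (K.neg_mem (K.pow_mem hw _))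
            (neg_ne_zero.2 (pow_ne_zero _ hw0)) (by
              rintro ⟨c, hcK, hc⟩
              exact hw0 (hnsq w c (hKL hw) (hKL hcK) (by linear_combination -hc)))
          refine ⟨z, hzL, ?_, by rw [← hz]; ring⟩
          rintro rfl
          apply hne; rw [hz]; ring
      obtain ⟨z1, hz1L, hz10, hz1⟩ := hx' (u + v) (K.add_mem huK hvK)
      obtain ⟨z2, hz2L, hz20, hz2⟩ := hx' (u - v) (K.sub_mem huK hvK)
      rw [hsum, pow_succ, frob] at hnorm
      set a : F := (h1 : F) with ha
      set b : F := (h2 : F) with hb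
      set E : F := a * b ^ q - a ^ q * b with hE
      have hE2 : E ^ 2 = (z1 * z2) ^ 2 := by
        have hT : a * b ^ q + a ^ q * b = - x ^ 2 - u ^ 2 - v ^ 2 := by
          linear_combination hnorm - hu - hv
        have h3 : E ^ 2 = (a * b ^ q + a ^ q * b) ^ 2 - 4 * (a ^ q * a) * (b ^ q * b) := by
          rw [hE]; ring
        rw [h3, hT, hu, hv, mul_pow, ← hz1, ← hz2]; ring
      have hEq : E ^ q = -E := by
        rw [hE, sub_eq_add_neg, frob, Odd.neg_pow hqodd, mul_pow, mul_pow, hcar, hcar]; ring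
      have hEL : E ∈ L := by
        rcases sq_eq_sq_iff_eq_or_eq_neg.1 hE2 with h | h
        · rw [h]; exact L.mul_mem hz1L hz2L
        · rw [h]; exact L.neg_mem (L.mul_mem hz1L hz2L)
      have hE1 := (hLm E).1 hEL
      have hE0 : E = 0 := by
        have : 2 * E = 0 := by linear_combination hEq - hE1
        exact (mul_eq_zero.1 this).resolve_left h2F
      rw [hE0] at hE2
      exact pow_ne_zero 2 (mul_ne_zero hz10 hz20) (by rw [← hE2]; ring)
end

section
/- Assume the standard setup with q0 ≡ 7 (mod 8), and let m = (q0−1)/2. Suppose s satisfies the real inequality q0^s + 1 − 2·(1 + 2^{m−1}·(m−2))·√(q0^s) > 2^m. Then the covering radius of C_s(q0) equals 3; concretely: (1) every μ ∈ F can be written as μ = c1·h1 + c2·h2 + c3·h3 with c1, c2, c3 ∈ K and h1, h2, h3 ∈ H, and (2) there exists μ ∈ F such that μ ≠ c1·h1 + c2·h2 for all c1, c2 ∈ K and all h1, h2 ∈ H. -/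
namespace CovRad
open Polynomial

lemma dvd_of_taylor_coeff {L : Type*} [Field L] (R : L[X]) (α : L) (l : ℕ)
    (h : ∀ k < l, (taylor α R).coeff k = 0) : (X - C α) ^ l ∣ R := by
  obtain ⟨g, hg⟩ := X_pow_dvd_iff.2 h
  have h1 : taylor (-α) (taylor α R) = R := by
    rw [taylor_taylor]; simp
  rw [hg, taylor_mul, taylor_X_pow] at h1
  rw [← h1]
  simp [sub_eq_add_neg]

/-- The abstract Stepanov argument. -/
lemma stepanov_abstract {L : Type*} [Field L] {ι : Type*} [Fintype ι]
    (R : ι → L[X]) (hR : ∀ c : ι → L, ∑ x, C (c x) * R x = 0 → c = 0)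
    (l M : ℕ) (E : ℕ → ℕ) (P : ι → ℕ → L[X]) (S : Finset L) (w : L → ℕ → L)
    (hP : ∀ x, ∀ k < l, ∀ α ∈ S, (taylor α (R x)).coeff k = w α k * (P x k).eval α)
    (hE : ∀ x, ∀ k < l, (P x k).natDegree < E k)
    (hcard : ∑ k ∈ Finset.range l, E k < Fintype.card ι)
    (hM : ∀ x, (R x).natDegree ≤ M) : l * S.card ≤ M := by
  classical
  let A : Matrix (Σ k : Fin l, Fin (E k)) ι L := fun t x => (P x t.1).coeff t.2
  have hker : LinearMap.ker A.mulVecLin ≠ ⊥ := by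
    apply LinearMap.ker_ne_bot_of_finrank_lt
    simp only [Module.finrank_fintype_fun_eq_card, Fintype.card_sigma, Fintype.card_fin]
    rw [Finset.sum_range] at hcard
    exact hcard
  obtain ⟨c, hc, hc0⟩ := (Submodule.ne_bot_iff _).1 hker
  have hPc : ∀ k < l, ∑ x, C (c x) * P x k = 0 := by
    intro k hk
    ext t
    simp only [finsetSum_coeff, coeff_C_mul, coeff_zero]
    by_cases ht : t < E k
    · have := congrFun (LinearMap.mem_ker.1 hc) ⟨⟨k, hk⟩, ⟨t, ht⟩⟩
      simp only [Pi.zero_apply, A] at this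
      rw [← this]
      exact Finset.sum_congr rfl fun x _ => mul_comm _ _
    · apply Finset.sum_eq_zero
      intro x _
      rw [coeff_eq_zero_of_natDegree_lt (by have := hE x k hk; omega), mul_zero]
  set T := ∑ x, C (c x) * R x with hT
  have hT0 : T ≠ 0 := fun h => hc0 (hR c h)
  have hdvd : ∀ α ∈ S, (X - C α) ^ l ∣ T := by
    intro α hα
    apply dvd_of_taylor_coeff
    intro k hk
    have := congrArg (eval α) (hPc k hk)
    simp only [eval_finsetSum, eval_mul, eval_C, eval_zero] at this
    simp only [hT, map_sum, taylor_mul, taylor_C, finsetSum_coeff, coeff_C_mul]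
    calc _ = ∑ x, w α k * (c x * (P x k).eval α) :=
          Finset.sum_congr rfl fun x _ => by rw [hP x k hk α hα]; ring
      _ = 0 := by rw [← Finset.mul_sum, this, mul_zero]
  have hprod : ∏ α ∈ S, (X - C α) ^ l ∣ T := by
    apply Finset.prod_dvd_of_coprime _ hdvd
    intro a _ b _ hab
    exact (pairwise_coprime_X_sub_C (s := fun x : L => x) Function.injective_id hab).pow
  have h1 := natDegree_le_of_dvd hprod hT0
  rw [natDegree_prod_of_monic _ _ (fun α _ => (monic_X_sub_C α).pow l)] at h1
  simp only [natDegree_pow, natDegree_X_sub_C, mul_one, Finset.sum_const, smul_eq_mul] at h1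
  have h2 : T.natDegree ≤ M := by
    apply natDegree_sum_le_of_forall_le
    intro x _
    exact (natDegree_C_mul_le _ _).trans (hM x)
  rw [mul_comm]
  exact h1.trans h2

lemma pow_dvd_hasseDeriv {L : Type*} [Field L] (f : L[X]) (N k : ℕ) :
    f ^ (N - k) ∣ hasseDeriv k (f ^ N) := by
  induction N generalizing k with
  | zero => simp
  | succ N ih =>
    rw [pow_succ', hasseDeriv_mul]
    apply Finset.dvd_sum
    rintro ⟨a, b⟩ hab
    rw [Finset.HasAntidiagonal.mem_antidiagonal] at hab
    simp only at hab ⊢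
    rcases Nat.eq_zero_or_pos a with rfl | ha
    · have : b = k := by omega
      subst this
      rw [hasseDeriv_zero]
      refine (pow_dvd_pow f (show N + 1 - b ≤ (N - b) + 1 by omega)).trans ?_
      rw [pow_succ']
      exact mul_dvd_mul_left _ (ih b)
    · exact ((pow_dvd_pow f (show N + 1 - k ≤ N - b by omega)).trans (ih b)).mul_left _

lemma pow_dvd_hasseDeriv_mul {L : Type*} [Field L] (f u : L[X]) (N k : ℕ) :
    f ^ (N - k) ∣ hasseDeriv k (f ^ N * u) := by
  rw [hasseDeriv_mul]
  apply Finset.dvd_sum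
  rintro ⟨a, b⟩ hab
  rw [Finset.HasAntidiagonal.mem_antidiagonal] at hab
  simp only at hab ⊢
  exact ((pow_dvd_pow f (show N - k ≤ N - a by omega)).trans (pow_dvd_hasseDeriv f N a)).mul_right _

lemma exists_quot {L : Type*} [Field L] (f u : L[X]) (N k d : ℕ) (hf : f.natDegree = d)
    (hd : 1 ≤ d) (hk : k ≤ N) :
    ∃ Q : L[X], hasseDeriv k (f ^ N * u) = f ^ (N - k) * Q ∧
      Q.natDegree ≤ u.natDegree + k * (d - 1) := by
  obtain ⟨Q, hQ⟩ := pow_dvd_hasseDeriv_mul f u N k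
  refine ⟨Q, hQ, ?_⟩
  by_cases hQ0 : Q = 0
  · simp [hQ0]
  have hf0 : f ≠ 0 := by rintro rfl; simp at hf; omega
  have h1 := natDegree_hasseDeriv_le (f ^ N * u) k
  rw [hQ, natDegree_mul (pow_ne_zero _ hf0) hQ0, natDegree_pow, hf] at h1
  have h2 : (f ^ N * u).natDegree ≤ N * d + u.natDegree := by
    refine natDegree_mul_le.trans ?_
    rw [natDegree_pow, hf]
  obtain ⟨e, rfl⟩ : ∃ e, d = e + 1 := ⟨d - 1, by omega⟩
  obtain ⟨n, rfl⟩ : ∃ n, N = k + n := ⟨N - k, by omega⟩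
  simp only [Nat.add_sub_cancel_left, Nat.add_sub_cancel] at *
  have h3 : (k + n) * (e + 1) = n * (e+1) + k * e + k := by ring
  omega

lemma taylor_coeff_mul_X_pow {L : Type*} [Field L] [Fintype L] (g : L[X]) (α : L) (k j : ℕ)
    (hk : k < Fintype.card L) :
    (taylor α (g * X ^ (Fintype.card L * j))).coeff k = (hasseDeriv k g).eval α * α ^ j := by
  set q := Fintype.card L with hq
  have h1 : taylor α (X ^ (q * j)) = (X ^ q + C α) ^ j := by
    rw [taylor_X_pow, pow_mul, hq, ← FiniteField.expand_card]
    simp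
  have h2 : (X : L[X]) ^ q ∣ (X ^ q + C α) ^ j - (C α) ^ j := by
    have := sub_dvd_pow_sub_pow (X ^ q + C α) (C α) j
    rwa [add_sub_cancel_right] at this
  obtain ⟨v, hv⟩ := h2
  rw [taylor_mul, h1, eq_add_of_sub_eq hv, mul_add, coeff_add, ← C_pow, coeff_mul_C, taylor_coeff,
    mul_left_comm, coeff_X_pow_mul', if_neg (by omega), zero_add]

lemma nontrivial_aux {L : Type*} [Field L] [Fintype L] (f : L[X]) (h A d : ℕ)
    (hq : Fintype.card L = 2 * h + 1) (hd : f.natDegree = d) (hA : 2 * A + d ≤ 2 * h + 2)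
    (hf0 : f.coeff 0 ≠ 0) (b : L) (hb : f.rootMultiplicity b = 1)
    (J : ℕ) (r s : ℕ → L[X]) (hr : ∀ j, (r j).degree < A) (hs : ∀ j, (s j).degree < A)
    (h0 : ∑ j ∈ Finset.range J, r j * X ^ (Fintype.card L * j) +
      f ^ h * ∑ j ∈ Finset.range J, s j * X ^ (Fintype.card L * j) = 0) :
    ∀ j < J, r j = 0 ∧ s j = 0 := by
  induction J generalizing r s with
  | zero => intro j hj; omega
  | succ J ih =>
    set q := Fintype.card L with hqdef
    have key : ∀ r : ℕ → L[X], ∑ j ∈ Finset.range (J + 1), r j * X ^ (q * j) =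
        r 0 + X ^ q * ∑ j ∈ Finset.range J, r (j + 1) * X ^ (q * j) := by
      intro r
      rw [Finset.sum_range_succ', Finset.mul_sum, add_comm]
      simp only [mul_zero, pow_zero, mul_one]
      congr 1
      refine Finset.sum_congr rfl fun j _ => ?_
      rw [mul_add, pow_add, mul_one]; ring
    rw [key r, key s] at h0
    set U := ∑ j ∈ Finset.range J, r (j + 1) * X ^ (q * j) with hU
    set V := ∑ j ∈ Finset.range J, s (j + 1) * X ^ (q * j) with hV
    have hfq : ∃ g : L[X], f ^ q = C (f.coeff 0) + X ^ q * g := by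
      refine ⟨expand L q f.divX, ?_⟩
      rw [hqdef, ← FiniteField.expand_card]
      conv_lhs => rw [← divX_mul_X_add f]
      simp only [map_add, map_mul, expand_X, expand_C]
      ring
    obtain ⟨g, hg⟩ := hfq
    have hz : r 0 ^ 2 * f - C (f.coeff 0) * s 0 ^ 2 = 0 := by
      have hdv : X ^ q ∣ r 0 ^ 2 * f - C (f.coeff 0) * s 0 ^ 2 := by
        have e1 : (r 0 + X ^ q * U) = - (f ^ h * (s 0 + X ^ q * V)) := eq_neg_of_add_eq_zero_left h0
        have e2 : (r 0 + X ^ q * U) ^ 2 * f = f ^ q * (s 0 + X ^ q * V) ^ 2 := by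
          rw [e1, hq]; ring
        rw [hg] at e2
        refine ⟨- ((2 * r 0 * U + X ^ q * U ^ 2) * f) + C (f.coeff 0) * (2 * s 0 * V + X ^ q * V ^ 2)
          + g * (s 0 + X ^ q * V) ^ 2, ?_⟩
        linear_combination e2
      apply eq_zero_of_dvd_of_natDegree_lt hdv
      rw [natDegree_X_pow, hq]
      by_cases hA0 : A = 0
      · have hr0 : r 0 = 0 := by
          have := hr 0; rw [hA0] at this; simpa [Nat.WithBot.lt_zero_iff] using this
        have hs0 : s 0 = 0 := by
          have := hs 0; rw [hA0] at this; simpa [Nat.WithBot.lt_zero_iff] using this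
        rw [hr0, hs0]; simp
      have hnd : ∀ p : L[X], p.degree < A → p.natDegree ≤ A - 1 := by
        intro p hp
        by_cases hp0 : p = 0
        · simp [hp0]
        have := (natDegree_lt_iff_degree_lt hp0).2 hp
        omega
      have n1 := hnd _ (hr 0)
      have n2 := hnd _ (hs 0)
      have n3 : (r 0 ^ 2 * f).natDegree ≤ 2 * (A - 1) + d := by
        refine natDegree_mul_le.trans ?_
        rw [hd, natDegree_pow]; omega
      have n4 : (C (f.coeff 0) * s 0 ^ 2).natDegree ≤ 2 * (A - 1) := by
        refine (natDegree_C_mul_le _ _).trans ?_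
        rw [natDegree_pow]; omega
      have := natDegree_sub_le (r 0 ^ 2 * f) (C (f.coeff 0) * s 0 ^ 2)
      have : max (r 0 ^ 2 * f).natDegree (C (f.coeff 0) * s 0 ^ 2).natDegree ≤ 2 * (A - 1) + d :=
        max_le n3 (by omega)
      omega
    have hf : f ≠ 0 := by rintro rfl; simp at hf0
    have hrs : r 0 = 0 ∧ s 0 = 0 := by
      by_cases hr0 : r 0 = 0
      · refine ⟨hr0, ?_⟩
        rw [hr0] at hz
        simpa [hf0] using hz
      · exfalso
        have hz' := sub_eq_zero.1 hz
        have hne : r 0 ^ 2 * f ≠ 0 := mul_ne_zero (pow_ne_zero _ hr0) hf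
        have hne' := hne
        rw [hz'] at hne'
        have hs0 : s 0 ≠ 0 := by
          intro h; rw [h] at hne'; simp at hne'
        have := congrArg (rootMultiplicity b) hz'
        rw [rootMultiplicity_mul hne, rootMultiplicity_mul hne', hb, rootMultiplicity_C, pow_two,
          pow_two, rootMultiplicity_mul (mul_ne_zero hr0 hr0),
          rootMultiplicity_mul (mul_ne_zero hs0 hs0)] at this
        omega
    have ih' := ih (fun j => r (j + 1)) (fun j => s (j + 1)) (fun j => hr _) (fun j => hs _) (by
      rw [hrs.1, hrs.2] at h0
      have : (X : L[X]) ^ q * (U + f ^ h * V) = 0 := by linear_combination h0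
      rcases mul_eq_zero.1 this with h | h
      · exact absurd h (pow_ne_zero _ X_ne_zero)
      · exact h)
    intro j hj
    rcases j with _ | j
    · exact hrs
    · exact ih' j (by omega)

end CovRad

namespace CovRad
open Polynomial

set_option maxHeartbeats 1000000 in
/-- Stepanov bound with free parameters. -/
lemma stepanov {L : Type*} [Field L] [Fintype L] (f : L[X]) (h A d J J' l : ℕ)
    (hq : Fintype.card L = 2 * h + 1) (hd : f.natDegree = d) (hd1 : 1 ≤ d)
    (hA : 2 * A + d ≤ 2 * h + 2)
    (hf0 : f.coeff 0 ≠ 0) (b : L) (hb : f.rootMultiplicity b = 1)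
    (hJ : 1 ≤ J) (hJJ : J' ≤ J) (hdJ : d ≤ 2 * (J - J')) (hl : l ≤ Fintype.card L)
    (hcond : ∑ k ∈ Finset.range l, (A + J + k * (d - 1)) < (J + J') * A)
    (ε : L) (S : Finset L) (hS : ∀ α ∈ S, f.eval α ^ h = ε) :
    l * S.card ≤ l * d + A + Fintype.card L * (J - 1) := by
  classical
  set q := Fintype.card L with hqdef
  have hquot : ∀ N i k : ℕ, ∃ Q : L[X], k ≤ N → hasseDeriv k (f ^ N * X ^ i) = f ^ (N - k) * Q ∧
      Q.natDegree ≤ i + k * (d - 1) := by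
    intro N i k
    by_cases hk : k ≤ N
    · obtain ⟨Q, hQ, hQ'⟩ := exists_quot f (X ^ i) N k d hd hd1 hk
      exact ⟨Q, fun _ => ⟨hQ, by simpa using hQ'⟩⟩
    · exact ⟨0, fun h => absurd h hk⟩
  choose Q hQ using hquot
  let R : (Fin J × Fin A) ⊕ (Fin J' × Fin A) → L[X] := Sum.elim
    (fun x => f ^ l * X ^ (x.2 : ℕ) * X ^ (q * (x.1 : ℕ)))
    (fun x => f ^ (l + h) * X ^ (x.2 : ℕ) * X ^ (q * (x.1 : ℕ)))
  let P : (Fin J × Fin A) ⊕ (Fin J' × Fin A) → ℕ → L[X] := Sum.elim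
    (fun x k => Q l x.2 k * X ^ (x.1 : ℕ))
    (fun x k => C ε * (Q (l + h) x.2 k * X ^ (x.1 : ℕ)))
  refine stepanov_abstract R ?_ l _ (fun k => A + J + k * (d - 1)) P S
    (fun α k => f.eval α ^ (l - k)) ?_ ?_ ?_ ?_
  · -- linear independence
    intro c hc
    let r : ℕ → L[X] := fun j => if hj : j < J then
      ∑ i : Fin A, C (c (Sum.inl (⟨j, hj⟩, i))) * X ^ (i : ℕ) else 0
    let s : ℕ → L[X] := fun j => if hj : j < J' then
      ∑ i : Fin A, C (c (Sum.inr (⟨j, hj⟩, i))) * X ^ (i : ℕ) else 0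
    have hdeg : ∀ g : Fin A → L, (∑ i : Fin A, C (g i) * X ^ (i : ℕ)).degree < (A : WithBot ℕ) := by
      intro g
      rw [← mem_degreeLT]
      refine Submodule.sum_mem _ fun i _ => ?_
      rw [mem_degreeLT]
      refine (degree_C_mul_X_pow_le _ _).trans_lt ?_
      exact_mod_cast i.2
    have hA0 : (0 : L[X]).degree < (A : WithBot ℕ) := by simp
    have hr : ∀ j, (r j).degree < A := by
      intro j
      by_cases hj : j < J
      · simp only [r, dif_pos hj]; exact hdeg _
      · simp only [r, dif_neg hj]; exact hA0
    have hs : ∀ j, (s j).degree < A := by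
      intro j
      by_cases hj : j < J'
      · simp only [s, dif_pos hj]; exact hdeg _
      · simp only [s, dif_neg hj]; exact hA0
    have hfne : f ≠ 0 := by rintro rfl; simp at hf0
    have e1 : ∑ j ∈ Finset.range J, r j * X ^ (q * j) =
        ∑ x : Fin J × Fin A, C (c (Sum.inl x)) * (X ^ (x.2 : ℕ) * X ^ (q * (x.1 : ℕ))) := by
      rw [Finset.sum_range, Fintype.sum_prod_type]
      refine Finset.sum_congr rfl fun j _ => ?_
      simp only [r, dif_pos j.2, Finset.sum_mul]
      exact Finset.sum_congr rfl fun i _ => by rw [mul_assoc]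
    have e2 : ∑ j ∈ Finset.range J, s j * X ^ (q * j) =
        ∑ x : Fin J' × Fin A, C (c (Sum.inr x)) * (X ^ (x.2 : ℕ) * X ^ (q * (x.1 : ℕ))) := by
      have : ∑ j ∈ Finset.range J, s j * X ^ (q * j) =
          ∑ j ∈ Finset.range J', s j * X ^ (q * j) := by
        symm
        apply Finset.sum_subset (Finset.range_subset_range.2 hJJ)
        intro j _ hj
        simp only [Finset.mem_range] at hj
        simp only [s, dif_neg hj, zero_mul]
      rw [this, Finset.sum_range, Fintype.sum_prod_type]
      refine Finset.sum_congr rfl fun j _ => ?_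
      simp only [s, dif_pos j.2, Finset.sum_mul]
      exact Finset.sum_congr rfl fun i _ => by rw [mul_assoc]
    have h0 : ∑ j ∈ Finset.range J, r j * X ^ (q * j) +
        f ^ h * ∑ j ∈ Finset.range J, s j * X ^ (q * j) = 0 := by
      have : f ^ l * (∑ j ∈ Finset.range J, r j * X ^ (q * j) +
        f ^ h * ∑ j ∈ Finset.range J, s j * X ^ (q * j)) = 0 := by
        refine Eq.trans ?_ hc
        rw [e1, e2, Fintype.sum_sum_type, mul_add, ← mul_assoc, ← pow_add, Finset.mul_sum,
          Finset.mul_sum]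
        congr 1
        · refine Finset.sum_congr rfl fun x _ => ?_
          simp only [R, Sum.elim_inl]; ring
        · refine Finset.sum_congr rfl fun x _ => ?_
          simp only [R, Sum.elim_inr]; ring
      exact (mul_eq_zero.1 this).resolve_left (pow_ne_zero _ hfne)
    have hall := nontrivial_aux f h A d hq hd hA hf0 b hb J r s hr hs h0
    have hcoef : ∀ (g : Fin A → L), (∑ i : Fin A, C (g i) * X ^ (i : ℕ)) = 0 → ∀ i, g i = 0 := by
      intro g hg i
      have := congrArg (fun p => coeff p (i : ℕ)) hg
      simp only [finsetSum_coeff, coeff_C_mul_X_pow, coeff_zero] at this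
      rw [Finset.sum_eq_single i] at this
      · simpa using this
      · intro b _ hb
        rw [if_neg]
        intro h; exact hb (Fin.ext h.symm)
      · simp
    funext x
    rcases x with ⟨j, i⟩ | ⟨j, i⟩
    · have := (hall j j.2).1
      simp only [r, dif_pos j.2] at this
      exact hcoef _ this i
    · have := (hall j (lt_of_lt_of_le j.2 hJJ)).2
      simp only [s, dif_pos j.2] at this
      exact hcoef _ this i
  · rintro (⟨j, i⟩ | ⟨j, i⟩) k hk α hα
    · simp only [R, P, Sum.elim_inl]
      rw [taylor_coeff_mul_X_pow _ _ _ _ (by omega), (hQ l i k hk.le).1]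
      simp only [eval_mul, eval_pow, eval_X]; ring
    · simp only [R, P, Sum.elim_inr]
      rw [taylor_coeff_mul_X_pow _ _ _ _ (by omega), (hQ (l + h) i k (by omega)).1]
      simp only [eval_mul, eval_pow, eval_X, eval_C]
      rw [show l + h - k = (l - k) + h by omega, pow_add, hS α hα]; ring
  · rintro (⟨j, i⟩ | ⟨j, i⟩) k hk
    · simp only [P, Sum.elim_inl]
      have := (hQ l i k hk.le).2
      have h2 : (Q l i k * X ^ (j : ℕ)).natDegree ≤ (Q l i k).natDegree + j := by
        refine natDegree_mul_le.trans ?_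
        simp
      have := i.2; have := j.2
      omega
    · simp only [P, Sum.elim_inr]
      have := (hQ (l + h) i k (by omega)).2
      have h2 : (Q (l + h) i k * X ^ (j : ℕ)).natDegree ≤ (Q (l + h) i k).natDegree + j := by
        refine natDegree_mul_le.trans ?_
        simp
      have h3 := natDegree_C_mul_le ε (Q (l + h) i k * X ^ (j : ℕ))
      have := i.2; have := j.2
      omega
  · refine hcond.trans_le (le_of_eq ?_)
    simp [add_mul]
  · rintro (⟨j, i⟩ | ⟨j, i⟩)
    · simp only [R, Sum.elim_inl]
      have h1 : (f ^ l * X ^ (i : ℕ) * X ^ (q * (j : ℕ))).natDegree ≤ l * d + i + q * j := by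
        refine natDegree_mul_le.trans (add_le_add (natDegree_mul_le.trans (add_le_add ?_ ?_)) ?_)
        · rw [natDegree_pow, hd]
        · simp
        · simp
      have h2 : q * (j : ℕ) ≤ q * (J - 1) := Nat.mul_le_mul_left _ (by have := j.2; omega)
      have := i.2
      omega
    · simp only [R, Sum.elim_inr]
      have h1 : (f ^ (l + h) * X ^ (i : ℕ) * X ^ (q * (j : ℕ))).natDegree ≤
          (l + h) * d + i + q * j := by
        refine natDegree_mul_le.trans (add_le_add (natDegree_mul_le.trans (add_le_add ?_ ?_)) ?_)
        · rw [natDegree_pow, hd]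
        · simp
        · simp
      have h2 : h * d + q * (j : ℕ) ≤ q * (J - 1) := by
        calc h * d + q * (j : ℕ) ≤ h * (2 * (J - J')) + q * j := by gcongr
          _ ≤ q * (J - J') + q * j := by
            have : h * (2 * (J - J')) = (2 * h) * (J - J') := by ring
            rw [this]
            gcongr
            omega
          _ = q * (J - J' + j) := by ring
          _ ≤ q * (J - 1) := Nat.mul_le_mul_left _ (by have := j.2; omega)
      have := i.2
      rw [add_mul] at h1
      omega

end CovRad

namespace CovRad
open Polynomial

/-- The character sum attached to a finite set `T`. -/
noncomputable def W {L : Type*} [Field L] [Fintype L] [DecidableEq L] (T : Finset L) : ℤ :=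
  ∑ n : L, ∏ b ∈ T, quadraticChar L (n - b)

lemma ringChar_ne_two {L : Type*} [Field L] [Fintype L] (h : ℕ)
    (hq : Fintype.card L = 2 * h + 1) : ringChar L ≠ 2 := by
  intro hc
  have := FiniteField.even_card_iff_char_two.1 hc
  omega

lemma stepanov_T {L : Type*} [Field L] [Fintype L] [DecidableEq L] (T : Finset L)
    (h A d J J' l : ℕ)
    (hq : Fintype.card L = 2 * h + 1) (hd : T.card = d) (hd1 : 1 ≤ d)
    (hdq : d < Fintype.card L)
    (hA : 2 * A + d ≤ 2 * h + 2)
    (hJ : 1 ≤ J) (hJJ : J' ≤ J) (hdJ : d ≤ 2 * (J - J')) (hl : l ≤ Fintype.card L)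
    (hcond : ∑ k ∈ Finset.range l, (A + J + k * (d - 1)) < (J + J') * A) :
    l * (Finset.univ.filter fun n : L => ∏ b ∈ T, quadraticChar L (n - b) = -1).card
      ≤ l * d + A + Fintype.card L * (J - 1) := by
  obtain ⟨β, hβ⟩ : ∃ β, β ∉ T := by
    by_contra hcon
    push Not at hcon
    have : T = Finset.univ := Finset.eq_univ_iff_forall.2 hcon
    rw [this, Finset.card_univ] at hd
    omega
  set T' := T.map (addRightEmbedding (-β)) with hT'
  set f : L[X] := ∏ a ∈ T', (X - C a) with hf
  have hfd : f.natDegree = d := by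
    rw [hf, natDegree_prod_of_monic _ _ (fun a _ => monic_X_sub_C a)]
    simp [hT', hd]
  obtain ⟨b, hb⟩ : T'.Nonempty := by
    rw [← Finset.card_pos, hT', Finset.card_map]; omega
  have hroot : f.rootMultiplicity b = 1 := by
    rw [← count_roots, hf, roots_prod_X_sub_C]
    exact Multiset.count_eq_one_of_mem T'.nodup hb
  have hf0 : f.coeff 0 ≠ 0 := by
    rw [coeff_zero_eq_eval_zero, hf, eval_prod, Finset.prod_ne_zero_iff]
    intro a ha
    rw [hT', Finset.mem_map] at ha
    obtain ⟨t, ht, rfl⟩ := ha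
    simp only [addRightEmbedding_apply, eval_sub, eval_X, eval_C]
    intro h0
    apply hβ
    have : t = β := by linear_combination -h0
    rwa [← this]
  have hchar := ringChar_ne_two h hq
  set N := (Finset.univ.filter fun n : L => ∏ b ∈ T, quadraticChar L (n - b) = -1) with hN
  have := stepanov f h A d J J' l hq hfd hd1 hA hf0 b hroot hJ hJJ hdJ hl hcond (-1)
    (N.map (addRightEmbedding (-β))) (by
      intro α hα
      rw [Finset.mem_map] at hα
      obtain ⟨n, hn, rfl⟩ := hα
      rw [hN, Finset.mem_filter] at hn
      rw [hf, eval_prod, hT', Finset.prod_map, ← Finset.prod_pow]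
      have h1 := congrArg (fun z : ℤ => (z : L)) hn.2
      push_cast at h1
      rw [← h1]
      refine Finset.prod_congr rfl fun t _ => ?_
      rw [quadraticChar_eq_pow_of_char_ne_two' hchar, hq, show (2 * h + 1) / 2 = h by omega]
      simp)
  rwa [Finset.card_map] at this

lemma prod_char_cases {L : Type*} [Field L] [Fintype L] [DecidableEq L] (T : Finset L) (n : L)
    (hn : n ∉ T) : ∏ b ∈ T, quadraticChar L (n - b) = 1 ∨
      ∏ b ∈ T, quadraticChar L (n - b) = -1 := by
  rw [← map_prod]
  apply quadraticChar_dichotomy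
  rw [Finset.prod_ne_zero_iff]
  intro b hb h0
  exact hn (by rwa [sub_eq_zero.1 h0])

lemma W_lower {L : Type*} [Field L] [Fintype L] [DecidableEq L] (T : Finset L) :
    (Fintype.card L : ℤ) - T.card -
      2 * (Finset.univ.filter fun n : L => ∏ b ∈ T, quadraticChar L (n - b) = -1).card ≤ W T := by
  have h1 : ∀ n : L, (1 : ℤ) - (if n ∈ T then 1 else 0) -
      2 * (if ∏ b ∈ T, quadraticChar L (n - b) = -1 then 1 else 0) ≤
      ∏ b ∈ T, quadraticChar L (n - b) := by
    intro n
    by_cases hn : n ∈ T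
    · have h0 : ∏ b ∈ T, quadraticChar L (n - b) = 0 := by
        apply Finset.prod_eq_zero hn
        simp
      rw [h0]; simp [hn]
    · rcases prod_char_cases T n hn with h | h <;> rw [h] <;> simp [hn]
  have h2 := Finset.sum_le_sum (fun n (_ : n ∈ Finset.univ) => h1 n)
  rw [Finset.sum_sub_distrib, Finset.sum_sub_distrib, ← Finset.mul_sum] at h2
  simp only [Finset.sum_boole, Finset.sum_const, Finset.card_univ, Finset.filter_mem_eq_inter,
    Finset.univ_inter] at h2
  simpa [W] using h2

lemma sum_W {L : Type*} [Field L] [Fintype L] [DecidableEq L] (B : Finset L) :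
    ∑ n : L, (∏ b ∈ B, (1 + quadraticChar L (n - b)) + ∏ b ∈ B, (1 - quadraticChar L (n - b))) =
      ∑ T ∈ B.powerset, (1 + (-1) ^ T.card) * W T := by
  have h1 : ∀ n : L, (∏ b ∈ B, (1 + quadraticChar L (n - b)) +
      ∏ b ∈ B, (1 - quadraticChar L (n - b))) =
      ∑ T ∈ B.powerset, (1 + (-1) ^ T.card) * ∏ b ∈ T, quadraticChar L (n - b) := by
    intro n
    simp only [sub_eq_add_neg (1 : ℤ)]
    rw [Finset.prod_one_add, Finset.prod_one_add, ← Finset.sum_add_distrib]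
    refine Finset.sum_congr rfl fun T _ => ?_
    rw [Finset.prod_neg]; ring
  rw [Finset.sum_congr rfl fun n _ => h1 n, Finset.sum_comm]
  refine Finset.sum_congr rfl fun T _ => ?_
  rw [W, Finset.mul_sum]

lemma char_le_one {L : Type*} [Field L] [Fintype L] [DecidableEq L] (a : L) :
    quadraticChar L a ≤ 1 ∧ -1 ≤ quadraticChar L a := by
  by_cases h : a = 0
  · simp [h]
  · rcases quadraticChar_dichotomy h with h | h <;> rw [h] <;> simp

lemma exists_n {L : Type*} [Field L] [Fintype L] [DecidableEq L] (B : Finset L) 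
    (hsum : 2 * (B.card : ℤ) * 2 ^ B.card < ∑ T ∈ B.powerset, (1 + (-1) ^ T.card) * W T) :
    ∃ n : L, (∀ b ∈ B, quadraticChar L (n - b) = 1) ∨ (∀ b ∈ B, quadraticChar L (n - b) = -1) := by
  by_contra hcon
  push Not at hcon
  rw [← sum_W] at hsum
  have h1 : ∀ n : L, (∏ b ∈ B, (1 + quadraticChar L (n - b)) +
      ∏ b ∈ B, (1 - quadraticChar L (n - b))) ≤ if n ∈ B then 2 * 2 ^ B.card else 0 := by
    intro n
    split_ifs with hn
    · have e1 : ∏ b ∈ B, (1 + quadraticChar L (n - b)) ≤ ∏ b ∈ B, 2 := by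
        apply Finset.prod_le_prod
        · intro b _; have := char_le_one (n - b); linarith
        · intro b _; have := char_le_one (n - b); linarith
      have e2 : ∏ b ∈ B, (1 - quadraticChar L (n - b)) ≤ ∏ b ∈ B, 2 := by
        apply Finset.prod_le_prod
        · intro b _; have := char_le_one (n - b); linarith
        · intro b _; have := char_le_one (n - b); linarith
      rw [Finset.prod_const] at e1 e2
      linarith
    · have hd : ∀ b ∈ B, quadraticChar L (n - b) = 1 ∨ quadraticChar L (n - b) = -1 := by
        intro b hb
        apply quadraticChar_dichotomy
        intro h0
        exact hn (by rwa [sub_eq_zero.1 h0])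
      obtain ⟨⟨b, hb, hb1⟩, ⟨c, hc, hc1⟩⟩ := hcon n
      rw [Finset.prod_eq_zero hb, Finset.prod_eq_zero hc]
      · simp
      · rw [(hd c hc).resolve_right hc1]; norm_num
      · rw [(hd b hb).resolve_left hb1]; norm_num
  have h2 := Finset.sum_le_sum (fun n (_ : n ∈ Finset.univ) => h1 n)
  rw [Finset.sum_ite_mem, Finset.univ_inter, Finset.sum_const, nsmul_eq_mul] at h2
  linarith

lemma sum_weight {α : Type*} [DecidableEq α] (B : Finset α) (hB : Even B.card) (hB0 : B.Nonempty) :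
    2 * ∑ T ∈ B.powerset, (1 + (-1 : ℤ) ^ T.card) * T.card = B.card * 2 ^ B.card := by
  have h1 : ∑ T ∈ B.powerset, (1 + (-1 : ℤ) ^ T.card) * T.card =
      ∑ T ∈ B.powerset, (1 + (-1 : ℤ) ^ T.card) * (B.card - T.card) := by
    refine Finset.sum_nbij' (fun T => B \ T) (fun T => B \ T) ?_ ?_ ?_ ?_ ?_
    · intro T _; simp
    · intro T _; simp
    · intro T hT; simp only [Finset.mem_powerset] at hT; simp [Finset.inter_eq_right.2 hT]
    · intro T hT; simp only [Finset.mem_powerset] at hT; simp [Finset.inter_eq_right.2 hT]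
    · intro T hT
      simp only [Finset.mem_powerset] at hT
      have hc := Finset.card_sdiff_add_card_eq_card hT
      have hc' : ((B \ T).card : ℤ) = B.card - T.card := by rw [← hc]; push_cast; ring
      have hp : (-1 : ℤ) ^ (B \ T).card = (-1) ^ T.card := by
        apply neg_one_pow_congr
        rw [← hc, Nat.even_add] at hB
        exact hB
      rw [hp, hc']
      ring
  have h2 : ∑ T ∈ B.powerset, (1 + (-1 : ℤ) ^ T.card) = 2 ^ B.card := by
    rw [Finset.sum_add_distrib, Finset.sum_powerset_neg_one_pow_card, if_neg hB0.ne_empty]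
    simp
  rw [two_mul]
  nth_rewrite 2 [h1]
  rw [← Finset.sum_add_distrib, ← h2, Finset.mul_sum]
  refine Finset.sum_congr rfl fun T _ => ?_
  ring

lemma W_empty {L : Type*} [Field L] [Fintype L] [DecidableEq L] :
    W (∅ : Finset L) = Fintype.card L := by simp [W]

lemma W_pair {L : Type*} [Field L] [Fintype L] [DecidableEq L] (h : ℕ)
    (hq : Fintype.card L = 2 * h + 1) (a b : L) (hab : a ≠ b) :
    W ({a, b} : Finset L) = -1 := by
  have hchar := ringChar_ne_two h hq
  have hba : b - a ≠ 0 := sub_ne_zero.2 hab.symm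
  have hj := jacobiSum_nontrivial_inv (quadraticChar_ne_one hchar)
  rw [(quadraticChar_isQuadratic L).inv, jacobiSum] at hj
  rw [W]
  simp only [Finset.prod_pair hab]
  have e : ∑ n : L, quadraticChar L (n - a) * quadraticChar L (n - b) =
      ∑ x : L, quadraticChar L (-1) * (quadraticChar L x * quadraticChar L (1 - x)) := by
    symm
    refine Fintype.sum_equiv ((Equiv.mulRight₀ (b - a) hba).trans (Equiv.addRight a)) _ _ ?_
    intro x
    simp only [Equiv.trans_apply, Equiv.mulRight₀_apply, Equiv.coe_addRight]
    rw [← map_mul, ← map_mul, ← map_mul]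
    have : (x * (b - a) + a - a) * (x * (b - a) + a - b) = (b - a) ^ 2 * (-1 * (x * (1 - x))) := by
      ring
    rw [this, map_mul _ ((b - a) ^ 2), quadraticChar_sq_one' hba, one_mul, map_mul]
  rw [e, ← Finset.mul_sum, hj]
  have : quadraticChar L (-1) * quadraticChar L (-1) = 1 := by
    rw [← map_mul]; simp
  linarith

end CovRad

namespace CovRad
open Polynomial

lemma W_four {L : Type*} [Field L] [Fintype L] [DecidableEq L] (h : ℕ)
    (hq : Fintype.card L = 2 * h + 1) (hbig : 343 ≤ Fintype.card L) (T : Finset L)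
    (hT : T.card = 4) : -(2 * (Fintype.card L : ℤ) + 81) ≤ 7 * W T := by
  have h1 := stepanov_T T h (h - 1) 4 5 3 7 hq hT (by norm_num) (by omega) (by omega) (by norm_num)
    (by norm_num) (by norm_num) (by omega) (by
      simp only [Finset.sum_range_succ, Finset.sum_range_zero]
      omega)
  have h2 := W_lower T
  rw [hT] at h2
  omega

lemma W_large {L : Type*} [Field L] [Fintype L] [DecidableEq L] (h e : ℕ)
    (hq : Fintype.card L = 2 * h + 1) (T : Finset L) (hT : T.card = 2 * e) (he : 1 ≤ e)
    (Q : ℝ) (hQ : Q ^ 2 = Fintype.card L) (hQ1 : 10000 ≤ Q) (hQ2 : 100 * (2 * (e : ℝ) + 3) ≤ Q) :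
    -(1.45 * (2 * e) * Q) ≤ (W T : ℝ) := by
  set q := Fintype.card L with hqdef
  set J := ⌊Q / 3⌋₊ with hJdef
  have hJ1 : (3 * J : ℝ) ≤ Q := by
    have := Nat.floor_le (show 0 ≤ Q / 3 by linarith)
    rw [← hJdef] at this
    linarith
  have hJ2 : Q < 3 * J + 3 := by
    have := Nat.lt_floor_add_one (Q / 3)
    rw [← hJdef] at this
    linarith
  obtain ⟨δ, hδ1, hδ2⟩ : ∃ δ : ℕ, 18 * e ≤ 20 * δ ∧ 20 * δ ≤ 18 * e + 19 :=
    ⟨(18 * e + 19) / 20, by omega, by omega⟩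
  have heJ : 10 * e + 1000 ≤ J := by
    have : (10 * e + 1000 : ℝ) ≤ J := by linarith
    exact_mod_cast this
  obtain ⟨l, hl⟩ : ∃ l, l + e + δ = 2 * J := ⟨2 * J - e - δ, by omega⟩
  have heR : (1 : ℝ) ≤ e := by exact_mod_cast he
  have hqR : (q : ℝ) = 2 * h + 1 := by exact_mod_cast hq
  have hd1R : (18 * e : ℝ) ≤ 20 * δ := by exact_mod_cast hδ1
  have hd2R : (20 * δ : ℝ) ≤ 18 * e + 19 := by exact_mod_cast hδ2
  have hlR : (l : ℝ) + e + δ = 2 * J := by exact_mod_cast hl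
  have hJpos : (0 : ℝ) ≤ J := Nat.cast_nonneg _
  have hlpos : (0 : ℝ) ≤ l := Nat.cast_nonneg _
  have hQq : Q * 10000 ≤ q := by rw [← hQ]; nlinarith
  have heh : e ≤ h := by
    have : (e : ℝ) ≤ h := by linarith
    exact_mod_cast this
  obtain ⟨A, hA⟩ : ∃ A, A + e = h + 1 := ⟨h + 1 - e, by omega⟩
  have hAR : (A : ℝ) + e = h + 1 := by exact_mod_cast hA
  have hlq : l ≤ q := by
    have : (l : ℝ) ≤ q := by linarith
    exact_mod_cast this
  have hcond : ∑ k ∈ Finset.range l, (A + J + k * (2 * e - 1)) < (J + (J - e)) * A := by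
    rw [Finset.sum_add_distrib, ← Finset.sum_mul, Finset.sum_const, Finset.card_range, smul_eq_mul]
    have hg := Finset.sum_range_id_mul_two l
    set G := ∑ k ∈ Finset.range l, k with hG
    have hG2 : G * 2 ≤ l * l := by rw [hg]; exact Nat.mul_le_mul_left _ (by omega)
    have hG2R : (G : ℝ) * 2 ≤ l * l := by exact_mod_cast hG2
    have h1 : (J + (J - e)) = l + δ := by omega
    rw [h1]
    have h2 : ((2 * e - 1 : ℕ) : ℝ) = 2 * e - 1 := by
      rw [Nat.cast_sub (by omega)]; push_cast; ring
    have key : ((l * (A + J) + G * (2 * e - 1) : ℕ) : ℝ) < ((l + δ) * A : ℕ) := by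
      push_cast
      rw [h2]
      have hl2 : (l : ℝ) ≤ 2 * J := by linarith [(Nat.cast_nonneg δ : (0 : ℝ) ≤ δ)]
      have s1 : (G : ℝ) * (2 * e - 1) ≤ l * J * (2 * e - 1) := by
        apply mul_le_mul_of_nonneg_right _ (by linarith)
        have := mul_le_mul_of_nonneg_left hl2 hlpos
        linarith
      have s2 : (l : ℝ) * J * (2 * e) ≤ 4 * e * J ^ 2 := by
        have : (l : ℝ) * J ≤ 2 * J * J := mul_le_mul_of_nonneg_right hl2 hJpos
        have := mul_le_mul_of_nonneg_right this (show (0 : ℝ) ≤ 2 * e by linarith)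
        linarith
      have s3 : 9 * (J : ℝ) ^ 2 ≤ q := by
        rw [← hQ]
        have := mul_self_le_mul_self (show (0 : ℝ) ≤ 3 * J by linarith) hJ1
        linarith
      have s4 : (4 * e * J ^ 2 : ℝ) ≤ e * (4 / 9 * q) := by
        have := mul_le_mul_of_nonneg_left s3 (show (0 : ℝ) ≤ e by linarith)
        linarith
      have s5 : (0.9 * e) * A ≤ (δ : ℝ) * A := by
        apply mul_le_mul_of_nonneg_right _ (Nat.cast_nonneg _)
        linarith
      have s6 : e * (4 / 9 * q : ℝ) < (0.9 * e) * A := by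
        have : (4 / 9 * q : ℝ) < 0.9 * A := by linarith
        have := mul_lt_mul_of_pos_left this (show (0 : ℝ) < e by linarith)
        linarith
      linarith
    exact_mod_cast key
  have hdq : 2 * e < q := by
    have : (2 * e : ℝ) < q := by linarith
    exact_mod_cast this
  have hst := stepanov_T T h A (2 * e) J (J - e) l hq hT (by omega) hdq (by omega) (by omega)
    (by omega) (by omega) hlq hcond
  have hW := W_lower T
  rw [hT] at hW
  set N := (Finset.univ.filter fun n : L => ∏ b ∈ T, quadraticChar L (n - b) = -1).card with hN
  have hWR : (q : ℝ) - 2 * e - 2 * N ≤ (W T : ℝ) := by exact_mod_cast hW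
  have hstR : (l : ℝ) * N ≤ l * (2 * e) + A + q * (J - 1) := by
    have h1 : ((J - 1 : ℕ) : ℝ) = J - 1 := by
      rw [Nat.cast_sub (by omega)]; push_cast; ring
    rw [← h1]
    exact_mod_cast hst
  have hl3 : 0.656 * Q ≤ l := by linarith
  have hm : (l : ℝ) * (2 * N - q - 4 * e) ≤ 1.9 * e * q := by
    have a1 : (q : ℝ) * (2 * J) = q * (l + e + δ) := by rw [hlR]
    have a2 : (q : ℝ) * δ ≤ q * (0.9 * e + 0.95) :=
      mul_le_mul_of_nonneg_left (by linarith) (Nat.cast_nonneg _)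
    have a3 : (q : ℝ) * 1 ≤ q * e := mul_le_mul_of_nonneg_left heR (Nat.cast_nonneg _)
    have a4 : (2 * A : ℝ) ≤ q := by linarith
    linarith
  have hfin : (2 * N - q - 4 * e : ℝ) ≤ 2.8966 * e * Q := by
    by_contra hcon
    push Not at hcon
    have b1 : (0.656 * Q) * (2.8966 * e * Q) ≤ l * (2.8966 * e * Q) :=
      mul_le_mul_of_nonneg_right hl3 (by positivity)
    have b2 : (l : ℝ) * (2.8966 * e * Q) ≤ l * (2 * N - q - 4 * e) :=
      mul_le_mul_of_nonneg_left hcon.le hlpos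
    have b3 : (0 : ℝ) < e * q := by
      have : (0 : ℝ) < q := by linarith
      positivity
    rw [← hQ] at hm b3 b2
    linarith
  have c1 : (e : ℝ) * 10000 ≤ e * Q := mul_le_mul_of_nonneg_left hQ1 (by linarith)
  linarith

lemma exists_large {L : Type*} [Field L] [Fintype L] [DecidableEq L] (h m : ℕ)
    (hq : Fintype.card L = 2 * h + 1) (hm : Odd m) (hm11 : 11 ≤ m) (B : Finset L)
    (hB : B.card = m + 1) (Q : ℝ) (hQ : Q ^ 2 = Fintype.card L)
    (hQ1 : 2 ^ m * ((m : ℝ) - 2) + 2 ≤ Q) :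
    ∃ n : L, (∀ b ∈ B, quadraticChar L (n - b) = 1) ∨ (∀ b ∈ B, quadraticChar L (n - b) = -1) := by
  have hmR : (11 : ℝ) ≤ m := by exact_mod_cast hm11
  have hp : (2048 : ℝ) ≤ 2 ^ m := by
    calc (2048 : ℝ) = 2 ^ 11 := by norm_num
      _ ≤ 2 ^ m := pow_le_pow_right₀ (by norm_num) hm11
  have hQ3 : 2048 * ((m : ℝ) - 2) ≤ Q := by nlinarith
  have hQ4 : 10000 ≤ Q := by linarith
  have hBe : Even B.card := by rw [hB]; exact hm.add_one
  have hBne : B.Nonempty := by rw [← Finset.card_pos]; omega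
  apply exists_n
  have hT : ∀ T ∈ B.powerset, (1 + (-1 : ℝ) ^ T.card) * (if T = ∅ then Q ^ 2 else 0)
      - 1.45 * Q * ((1 + (-1) ^ T.card) * T.card) ≤ (1 + (-1) ^ T.card) * (W T : ℝ) := by
    intro T hT
    rw [Finset.mem_powerset] at hT
    split_ifs with h0
    · rw [h0, W_empty, hQ]; simp
    · rcases Nat.even_or_odd T.card with hev | hodd
      · rw [hev.neg_one_pow]
        obtain ⟨e, he⟩ := hev
        have he2 : T.card = 2 * e := by omega
        have hpos : 0 < T.card := Finset.card_pos.2 (Finset.nonempty_iff_ne_empty.2 h0)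
        have hle : T.card ≤ m + 1 := hB ▸ Finset.card_le_card hT
        have hleR : (2 * e : ℝ) ≤ m + 1 := by rw [he2] at hle; exact_mod_cast hle
        have := W_large h e hq T he2 (by omega) Q hQ hQ4 (by linarith)
        rw [he2]
        push_cast
        linarith
      · rw [hodd.neg_one_pow]; simp
  have hs := Finset.sum_le_sum hT
  rw [Finset.sum_sub_distrib, ← Finset.mul_sum] at hs
  have hw := sum_weight B hBe hBne
  have hwR : 2 * ∑ T ∈ B.powerset, (1 + (-1 : ℝ) ^ T.card) * T.card = B.card * 2 ^ B.card := by
    exact_mod_cast hw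
  have h0 : ∑ T ∈ B.powerset, (1 + (-1 : ℝ) ^ T.card) * (if T = ∅ then Q ^ 2 else 0) = 2 * Q ^ 2 := by
    rw [Finset.sum_eq_single ∅]
    · simp; norm_num
    · intro T _ hT; simp [hT]
    · simp
  rw [h0] at hs
  rw [hB] at hwR
  have goalR : 2 * (B.card : ℝ) * 2 ^ B.card < ∑ T ∈ B.powerset, (1 + (-1 : ℝ) ^ T.card) * (W T : ℝ) := by
    refine lt_of_lt_of_le ?_ hs
    rw [hB]
    push_cast at hwR ⊢
    rw [pow_succ] at hwR ⊢
    set P : ℝ := 2 ^ m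
    have e1 : ∑ T ∈ B.powerset, (1 + (-1 : ℝ) ^ T.card) * (T.card : ℝ) = (m + 1) * P := by linarith
    rw [e1]
    have e2 : P * (0.725 * (m + 1) + 0.3) ≤ Q := by nlinarith
    have e3 : Q * (P * (0.725 * (m + 1) + 0.3)) ≤ Q * Q := mul_le_mul_of_nonneg_left e2 (by linarith)
    have e4 : P * (2 * (m + 1)) < P * (0.3 * Q) := mul_lt_mul_of_pos_left (by linarith) (by linarith)
    nlinarith
  exact_mod_cast goalR

lemma exists_four {L : Type*} [Field L] [Fintype L] [DecidableEq L] (h : ℕ)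
    (hq : Fintype.card L = 2 * h + 1) (hbig : 343 ≤ Fintype.card L) (B : Finset L)
    (hB : B.card = 4) :
    ∃ n : L, (∀ b ∈ B, quadraticChar L (n - b) = 1) ∨ (∀ b ∈ B, quadraticChar L (n - b) = -1) := by
  apply exists_n
  rw [hB, Finset.sum_powerset, hB]
  simp only [Finset.sum_range_succ, Finset.sum_range_zero]
  have h4 := W_four h hq hbig B hB
  have hc : ∀ j, ∑ T ∈ B.powersetCard j, (1 + (-1) ^ T.card) * W T =
      (1 + (-1) ^ j) * ∑ T ∈ B.powersetCard j, W T := by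
    intro j
    rw [Finset.mul_sum]
    refine Finset.sum_congr rfl fun T hT => ?_
    rw [(Finset.mem_powersetCard.1 hT).2]
  simp only [hc]
  have h2 : ∑ T ∈ B.powersetCard 2, W T = -6 := by
    have : ∀ T ∈ B.powersetCard 2, W T = -1 := by
      intro T hT
      obtain ⟨a, b, hab, rfl⟩ := Finset.card_eq_two.1 (Finset.mem_powersetCard.1 hT).2
      exact W_pair h hq a b hab
    rw [Finset.sum_congr rfl this, Finset.sum_const, Finset.card_powersetCard, hB]
    rfl
  have h4' : ∑ T ∈ B.powersetCard 4, W T = W B := by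
    rw [← hB, Finset.powersetCard_self, Finset.sum_singleton]
  rw [h2, h4', Finset.powersetCard_zero, Finset.sum_singleton, W_empty]
  norm_num
  omega

end CovRad

namespace CovRad
open Polynomial

lemma norm_facts {F : Type*} [Field F] [Fintype F] [DecidableEq F] (q : ℕ) (hq1 : 2 ≤ q)
    (hF : Fintype.card F = q ^ 2) (H : Subgroup Fˣ) (hH : Nat.card H = q + 1) :
    (∀ h : Fˣ, h ∈ H ↔ h ^ (q + 1) = 1) ∧
    (∀ n : F, n ^ q = n → n ≠ 0 → ∃ y : F, y ≠ 0 ∧ y ^ (q + 1) = n) ∧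
    (Finset.univ.filter fun x : F => x ^ q = x).card = q := by
  have hcu : Nat.card Fˣ = (q - 1) * (q + 1) := by
    rw [Nat.card_eq_fintype_card, Fintype.card_units, hF]
    obtain ⟨r, rfl⟩ : ∃ r, q = r + 1 := ⟨q - 1, by omega⟩
    rw [Nat.add_sub_cancel, Nat.sub_eq_iff_eq_add (by nlinarith)]
    ring
  let N : Fˣ →* Fˣ := powMonoidHom (q + 1)
  have hle : H ≤ N.ker := by
    intro h hh
    rw [MonoidHom.mem_ker]
    have := pow_card_eq_one' (x := (⟨h, hh⟩ : H))
    rw [hH] at this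
    exact congrArg Subtype.val this
  have hkc : Nat.card N.ker ≤ q + 1 := by
    have := IsCyclic.card_pow_eq_one_le (α := Fˣ) (n := q + 1) (by omega)
    refine le_trans (le_of_eq ?_) this
    rw [Nat.card_eq_fintype_card, ← Fintype.card_subtype]
    apply Fintype.card_congr
    exact Equiv.subtypeEquivRight fun x => by simp [N, MonoidHom.mem_ker]
  have hker : H = N.ker := Subgroup.eq_of_le_of_card_ge hle (by rw [hH]; exact hkc)
  have hrange : Nat.card N.range = q - 1 := by
    have h1 := Subgroup.card_mul_index N.ker
    rw [Subgroup.index_ker, ← hker, hH, hcu, mul_comm] at h1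
    exact Nat.eq_of_mul_eq_mul_right (by omega) h1
  have hrc : (Finset.univ.filter fun u : Fˣ => u ∈ N.range).card = q - 1 := by
    rw [← hrange, Nat.card_eq_fintype_card, ← Fintype.card_subtype]
  have hsub : (Finset.univ.filter fun u : Fˣ => u ∈ N.range) =
      Finset.univ.filter fun u : Fˣ => u ^ (q - 1) = 1 := by
    apply Finset.eq_of_subset_of_card_le
    · intro u hu
      simp only [Finset.mem_filter, Finset.mem_univ, true_and] at hu ⊢
      obtain ⟨y, rfl⟩ := hu
      simp only [N, powMonoidHom_apply]
      rw [← pow_mul, mul_comm, ← hcu, pow_card_eq_one']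
    · rw [hrc]
      exact IsCyclic.card_pow_eq_one_le (by omega)
  have hqq : ∀ u : Fˣ, (u : F) ^ q = u ↔ u ^ (q - 1) = 1 := by
    intro u
    rw [← Units.val_pow_eq_pow_val, Units.val_inj]
    conv_lhs => rw [show q = (q - 1) + 1 by omega, pow_succ]
    exact mul_eq_right
  refine ⟨?_, ?_, ?_⟩
  · intro h
    rw [hker, MonoidHom.mem_ker]
    rfl
  · intro n hn hn0
    have h1 := (hqq (Units.mk0 n hn0)).1 hn
    have h2 : Units.mk0 n hn0 ∈ (Finset.univ.filter fun u : Fˣ => u ∈ N.range) := by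
      rw [hsub]; simpa using h1
    simp only [Finset.mem_filter, Finset.mem_univ, true_and] at h2
    obtain ⟨y, hy⟩ := h2
    refine ⟨y, y.ne_zero, ?_⟩
    have := congrArg Units.val hy
    simpa [N] using this
  · have : (Finset.univ.filter fun x : F => x ^ q = x) =
        insert 0 ((Finset.univ.filter fun u : Fˣ => u ^ (q - 1) = 1).image Units.val) := by
      ext x
      simp only [Finset.mem_filter, Finset.mem_univ, true_and, Finset.mem_insert, Finset.mem_image]
      constructor
      · intro hx
        by_cases h0 : x = 0
        · exact Or.inl h0
        · exact Or.inr ⟨Units.mk0 x h0, (hqq _).1 hx, rfl⟩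
      · rintro (rfl | ⟨u, hu, rfl⟩)
        · exact zero_pow (by omega)
        · exact (hqq u).2 hu
    rw [this, Finset.card_insert_of_notMem (by simp), Finset.card_image_of_injective _ Units.val_injective,
      ← hsub, hrc]
    omega

/-- The squares of a subfield `K`, as a finset of a larger subfield. -/
lemma squares_finset {F : Type*} [Field F] [Fintype F] [DecidableEq F] (K L : Subfield F)
    (hKL : K ≤ L) (m q0 : ℕ) (hq0 : q0 = 2 * m + 1) (hm : 1 ≤ m) (hK : Nat.card K = q0) :
    ∃ B : Finset L, B.card = m + 1 ∧ ∀ a : F, a ∈ K → ∀ x : L, (x : F) = a ^ 2 → x ∈ B := by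
  classical
  let N : Kˣ →* Kˣ := powMonoidHom 2
  have hcu : Nat.card Kˣ = 2 * m := by
    rw [Nat.card_units, hK, hq0]; simp
  have hr : Nat.card N.range = m := by
    have := IsCyclic.card_powMonoidHom_range Kˣ 2
    rw [hcu, Nat.gcd_mul_right_left] at this
    rw [this]; omega
  let g : N.range → L := fun u => ⟨((u : Kˣ) : K), hKL ((u : Kˣ) : K).2⟩
  have hg : Function.Injective g := by
    intro u v huv
    have := congrArg Subtype.val huv
    simp only [g] at this
    exact Subtype.ext (Units.ext (Subtype.ext this))
  haveI : Fintype N.range := Fintype.ofFinite _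
  refine ⟨insert 0 (Finset.univ.image g), ?_, ?_⟩
  · rw [Finset.card_insert_of_notMem, Finset.card_image_of_injective _ hg, Finset.card_univ,
      ← Nat.card_eq_fintype_card, hr]
    intro h0
    obtain ⟨u, _, hu⟩ := Finset.mem_image.1 h0
    have := congrArg Subtype.val hu
    simp [g] at this
  · intro a ha x hx
    by_cases h0 : a = 0
    · have : x = 0 := by apply Subtype.ext; rw [hx, h0]; simp
      rw [this]; exact Finset.mem_insert_self _ _
    · apply Finset.mem_insert_of_mem
      rw [Finset.mem_image]
      have h0' : (⟨a, ha⟩ : K) ≠ 0 := fun h => h0 (congrArg Subtype.val h)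
      refine ⟨⟨N (Units.mk0 ⟨a, ha⟩ h0'), ⟨_, rfl⟩⟩, Finset.mem_univ _, ?_⟩
      apply Subtype.ext
      simp [g, N, hx]

lemma two_sum {F : Type*} [Field F] [Fintype F] [DecidableEq F] (q : ℕ) (hqodd : Odd q)
    (φ : F →+* F) (hφ : ∀ x, φ x = x ^ q) (h2 : (2 : F) ≠ 0)
    (L : Subfield F) (hL : ∀ x, x ∈ L ↔ φ x = x) (H : Subgroup Fˣ)
    (hmem : ∀ h : Fˣ, h ∈ H ↔ h ^ (q + 1) = 1)
    (hnorm : ∀ n : F, n ^ q = n → n ≠ 0 → ∃ y : F, y ≠ 0 ∧ y ^ (q + 1) = n)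
    (x : F) (hx : x ≠ 0) (N : F) (hN : x * φ x = N) (hNL : φ N = N)
    (hns : ∀ z : F, φ z = z → z ≠ 0 → N * (N - 1) ≠ z ^ 2) :
    ∃ u v : Fˣ, u ∈ H ∧ v ∈ H ∧ x = 2⁻¹ * (u : F) + 2⁻¹ * (v : F) := by
  have hNpow : ∀ y : F, y * φ y = y ^ (q + 1) := by intro y; rw [hφ, pow_succ]; ring
  have hunit : ∀ y : F, y * φ y = 1 → ∃ u : Fˣ, u ∈ H ∧ (u : F) = y := by
    intro y hy
    have hy0 : y ≠ 0 := by rintro rfl; simp at hy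
    refine ⟨Units.mk0 y hy0, ?_, rfl⟩
    rw [hmem]
    ext
    simp [← hNpow, hy]
  have hφ2 : φ 2 = 2 := map_ofNat φ 2
  obtain ⟨w, hw, hwφ⟩ : ∃ w : F, w ^ 2 = N * (N - 1) ∧ φ w = -w := by
    by_cases hD : N * (N - 1) = 0
    · exact ⟨0, by rw [hD]; ring, by simp⟩
    · have hDL : (N * (N - 1)) ^ q = N * (N - 1) := by
        rw [← hφ, map_mul, map_sub, map_one, hNL]
      obtain ⟨y, hy0, hy⟩ := hnorm _ hDL hD
      obtain ⟨k, hk⟩ := hqodd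
      have hw : (y ^ (k + 1)) ^ 2 = N * (N - 1) := by
        rw [← hy, hk, ← pow_mul]; congr 1; ring
      refine ⟨y ^ (k + 1), hw, ?_⟩
      have h1 : φ (y ^ (k + 1)) ^ 2 = (y ^ (k + 1)) ^ 2 := by
        rw [← map_pow, hw, hφ, hDL]
      rcases sq_eq_sq_iff_eq_or_eq_neg.1 h1 with h | h
      · exact absurd hw.symm (hns _ h (pow_ne_zero _ hy0))
      · exact h
  -- `u = (2 N - 1) + 2 w`
  obtain ⟨u, huH, hu⟩ := hunit (2 * N - 1 + 2 * w) (by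
    simp only [map_add, map_sub, map_mul, map_one, hφ2, hNL, hwφ]
    linear_combination (-4) * hw)
  have hN0 : N ≠ 0 := by
    rw [← hN]; exact mul_ne_zero hx (by simpa using hx)
  have hσ : (N + w) * φ (N + w) = N := by
    rw [map_add, hNL, hwφ]; linear_combination (-1) * hw
  have hσ0 : N + w ≠ 0 := by
    intro h; rw [h] at hσ; simp at hσ; exact hN0 hσ.symm
  have hφσ0 : φ (N + w) ≠ 0 := (map_ne_zero φ).2 hσ0
  obtain ⟨v, hvH, hv⟩ := hunit (x / (N + w)) (by
    rw [map_div₀, div_mul_div_comm, hN, hσ, div_self hN0])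
  refine ⟨u * v, v, H.mul_mem huH hvH, hvH, ?_⟩
  rw [Units.val_mul, hu, hv]
  field_simp
  ring

lemma part_one {F : Type*} [Field F] [Fintype F] [DecidableEq F] (q k : ℕ) (hqk : q = 2 * k + 1)
    (φ : F →+* F) (hφ : ∀ x, φ x = x ^ q) (hφφ : ∀ x, φ (φ x) = x) (h2 : (2 : F) ≠ 0)
    (L : Subfield F) (hL : ∀ x, x ∈ L ↔ φ x = x) (hLc : Nat.card L = q) (H : Subgroup Fˣ)
    (hH : Nat.card H = q + 1)
    (hmem : ∀ h : Fˣ, h ∈ H ↔ h ^ (q + 1) = 1)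
    (hnorm : ∀ n : F, n ^ q = n → n ≠ 0 → ∃ y : F, y ≠ 0 ∧ y ^ (q + 1) = n)
    (K : Subfield F) (μ : F) : ∃ c1 c2 c3 : F, c1 ∈ K ∧ c2 ∈ K ∧ c3 ∈ K ∧
        ∃ h1 h2 h3 : Fˣ, h1 ∈ H ∧ h2 ∈ H ∧ h3 ∈ H ∧
          μ = c1 * (h1 : F) + c2 * (h2 : F) + c3 * (h3 : F) := by
  classical
  have hhalf : (2⁻¹ : F) ∈ K := K.inv_mem (by
    have := K.add_mem K.one_mem K.one_mem
    rwa [one_add_one_eq_two] at this)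
  by_cases hμ : μ = 0
  · exact ⟨0, 0, 0, K.zero_mem, K.zero_mem, K.zero_mem, 1, 1, 1, H.one_mem, H.one_mem, H.one_mem,
      by simp [hμ]⟩
  have hφh : ∀ h ∈ H, φ (h : F) * h = 1 := by
    intro h hh
    have := congrArg Units.val ((hmem h).1 hh)
    rw [hφ, ← pow_succ]
    simpa using this
  haveI : Fintype L := Fintype.ofFinite _
  haveI : Fintype H := Fintype.ofFinite _
  rw [Nat.card_eq_fintype_card] at hLc hH
  let g : H → L := fun h => ⟨(μ - (h : Fˣ)) * φ (μ - (h : Fˣ)), by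
    rw [hL, map_mul, hφφ, mul_comm]⟩
  set bad : Finset L := Finset.univ.filter fun n : L =>
    quadraticChar L (n - 0) * quadraticChar L (n - 1) = 1 with hbad
  have hbadc : 2 * bad.card ≤ q - 1 := by
    have hW := W_pair k (hLc.trans hqk) (0 : L) 1 zero_ne_one
    rw [W] at hW
    simp only [Finset.prod_pair (zero_ne_one (α := L))] at hW
    have hle : ∀ n : L, 2 * (if quadraticChar L (n - 0) * quadraticChar L (n - 1) = 1 then 1 else 0)
        ≤ 1 + quadraticChar L (n - 0) * quadraticChar L (n - 1) := by
      intro n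
      split_ifs with h
      · rw [h]; norm_num
      · rw [← map_mul]
        have := char_le_one ((n - 0) * (n - 1))
        linarith
    have := Finset.sum_le_sum (fun n (_ : n ∈ Finset.univ) => hle n)
    rw [← Finset.mul_sum, Finset.sum_boole, Finset.sum_add_distrib, hW] at this
    simp only [Finset.sum_const, Finset.card_univ, hLc] at this
    rw [← hbad] at this
    simp at this
    omega
  obtain ⟨h, hh⟩ : ∃ h : H, g h ∉ bad := by
    by_contra hcon
    push Not at hcon
    obtain ⟨y, -, hy⟩ := Finset.exists_lt_card_fiber_of_mul_lt_card_of_maps_to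
      (s := (Finset.univ : Finset H)) (t := bad) (f := g) (n := 2) (fun h _ => hcon h)
      (by rw [Finset.card_univ, hH]; omega)
    rw [Finset.two_lt_card] at hy
    obtain ⟨a, ha, b, hb, c, hc, hab, hac, hbc⟩ := hy
    simp only [Finset.mem_filter, Finset.mem_univ, true_and] at ha hb hc
    have key : ∀ a b : H, g a = g b → a ≠ b → φ μ * (a : Fˣ) * (b : Fˣ) = μ := by
      intro a b hgab hab
      have h1 := congrArg Subtype.val hgab
      simp only [g, map_sub] at h1
      have ea := hφh a a.2
      have eb := hφh b b.2
      have hne : ((a : Fˣ) : F) - (b : Fˣ) ≠ 0 := by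
        intro h
        exact hab (Subtype.ext (Units.ext (sub_eq_zero.1 h)))
      apply mul_left_cancel₀ hne
      set A : F := ((a : Fˣ) : F)
      set B : F := ((b : Fˣ) : F)
      linear_combination (-A * B) * h1 + (-μ * B + A * B) * ea + (μ * A - A * B) * eb
    have k1 := key a b (ha.trans hb.symm) hab
    have k2 := key a c (ha.trans hc.symm) hac
    apply hbc
    apply Subtype.ext; apply Units.ext
    have hne : φ μ * ((a : Fˣ) : F) ≠ 0 := mul_ne_zero (by simpa using hμ) (Units.ne_zero _)
    exact mul_left_cancel₀ hne (k1.trans k2.symm)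
  by_cases hx : μ - (h : Fˣ) = 0
  · exact ⟨1, 0, 0, K.one_mem, K.zero_mem, K.zero_mem, h, 1, 1, h.2, H.one_mem, H.one_mem,
      by simp [sub_eq_zero.1 hx]⟩
  have hNL := (hL _).1 (g h).2
  obtain ⟨u, v, hu, hv, huv⟩ := two_sum q ⟨k, hqk⟩ φ hφ h2 L hL H hmem hnorm _ hx (g h) rfl hNL (by
    intro z hz hz0 hzz
    apply hh
    rw [hbad, Finset.mem_filter]
    refine ⟨Finset.mem_univ _, ?_⟩
    have e : (g h - 0) * (g h - 1) = (⟨z, (hL z).2 hz⟩ : L) ^ 2 := by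
      apply Subtype.ext
      push_cast
      rw [← hzz]; ring
    rw [← map_mul, e]
    apply quadraticChar_sq_one'
    intro h0
    exact hz0 (congrArg Subtype.val h0))
  refine ⟨1, 2⁻¹, 2⁻¹, K.one_mem, hhalf, hhalf, h, u, v, h.2, hu, hv, ?_⟩
  linear_combination huv

lemma part_two {F : Type*} [Field F] [Fintype F] [DecidableEq F] (q : ℕ)
    (φ : F →+* F) (hφ : ∀ x, φ x = x ^ q) (h2 : (2 : F) ≠ 0)
    (L : Subfield F) [Fintype L] (hL : ∀ x, x ∈ L ↔ φ x = x) (H : Subgroup Fˣ)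
    (hmem : ∀ h : Fˣ, h ∈ H ↔ h ^ (q + 1) = 1)
    (hnorm : ∀ n : F, n ^ q = n → n ≠ 0 → ∃ y : F, y ≠ 0 ∧ y ^ (q + 1) = n)
    (K : Subfield F) (hKL : K ≤ L) (B : Finset L)
    (hB : ∀ a : F, a ∈ K → ∀ x : L, (x : F) = a ^ 2 → x ∈ B) (n : L)
    (hn : (∀ b ∈ B, quadraticChar L (n - b) = 1) ∨ (∀ b ∈ B, quadraticChar L (n - b) = -1)) :
    ∃ μ : F, ∀ c1 c2 : F, c1 ∈ K → c2 ∈ K →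
        ∀ h1 h2 : Fˣ, h1 ∈ H → h2 ∈ H → μ ≠ c1 * (h1 : F) + c2 * (h2 : F) := by
  have hφh : ∀ h ∈ H, φ (h : F) * h = 1 := by
    intro h hh
    have := congrArg Units.val ((hmem h).1 hh)
    rw [hφ, ← pow_succ]
    simpa using this
  have hpair : ∀ a b : L, a ∈ B → b ∈ B → ∃ z : L, z ≠ 0 ∧ (n - a) * (n - b) = z ^ 2 := by
    intro a b ha hb
    have h1 : quadraticChar L ((n - a) * (n - b)) = 1 := by
      rw [map_mul]
      rcases hn with hn | hn <;> rw [hn a ha, hn b hb] <;> norm_num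
    have h0 : (n - a) * (n - b) ≠ 0 := by
      intro h; rw [h] at h1; simp at h1
    obtain ⟨z, hz⟩ := (quadraticChar_one_iff_isSquare h0).1 h1
    refine ⟨z, ?_, by rw [hz, sq]⟩
    rintro rfl
    rw [mul_zero] at hz
    exact h0 hz
  have hn0 : (n : F) ≠ 0 := by
    intro h
    have hB0 : (0 : L) ∈ B := hB 0 K.zero_mem 0 (by simp)
    obtain ⟨z, hz0, hz⟩ := hpair 0 0 hB0 hB0
    have : n = 0 := Subtype.ext h
    rw [this] at hz
    simp at hz
    exact hz0 (by simpa using hz.symm)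
  have hnq : (n : F) ^ q = n := by rw [← hφ]; exact (hL _).1 n.2
  obtain ⟨μ, hμ0, hμ⟩ := hnorm n hnq hn0
  refine ⟨μ, ?_⟩
  intro c1 c2 hc1 hc2 h1 h2' hh1 hh2 heq
  have f1 := (hL _).1 (hKL hc1)
  have f2 := (hL _).1 (hKL hc2)
  have e1 := hφh h1 hh1
  have e2 := hφh h2' hh2
  have hN : (n : F) = (c1 * h1 + c2 * h2') * (c1 * φ h1 + c2 * φ h2') := by
    rw [← hμ, pow_succ, ← hφ, heq, map_add, map_mul, map_mul, f1, f2]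
    ring
  have hm1 := K.add_mem hc1 hc2
  have hm2 := K.sub_mem hc1 hc2
  obtain ⟨z, hz0, hz⟩ := hpair ⟨(c1 + c2) ^ 2, hKL (K.pow_mem hm1 2)⟩
    ⟨(c1 - c2) ^ 2, hKL (K.pow_mem hm2 2)⟩ (hB _ hm1 _ rfl) (hB _ hm2 _ rfl)
  have hzF := congrArg Subtype.val hz
  push_cast at hzF
  rw [hN] at hzF
  have hzφ := (hL _).1 z.2
  set a : F := (h1 : F)
  set b : F := (h2' : F)
  have hsq : (c1 * c2 * (a * φ b - b * φ a)) ^ 2 = (z : F) ^ 2 := by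
    rw [← hzF]
    have g1 : φ a * a - 1 = 0 := by rw [e1]; ring
    have g2 : φ b * b - 1 = 0 := by rw [e2]; ring
    generalize φ a = a' at *
    generalize φ b = b' at *
    have e1' : a' * a = 1 := e1
    have e2' : b' * b = 1 := e2
    have x1 : (c1 * a + c2 * b) * (c1 * a' + c2 * b') - (c1 + c2) ^ 2 =
        c1 * c2 * (a * b' + b * a' - 2) := by
      linear_combination c1 ^ 2 * e1' + c2 ^ 2 * e2'
    have x2 : (c1 * a + c2 * b) * (c1 * a' + c2 * b') - (c1 - c2) ^ 2 =
        c1 * c2 * (a * b' + b * a' + 2) := by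
      linear_combination c1 ^ 2 * e1' + c2 ^ 2 * e2'
    rw [x1, x2]
    linear_combination (-4 * c1 ^ 2 * c2 ^ 2 * b * b') * e1' + (-4 * c1 ^ 2 * c2 ^ 2) * e2'
  have hφφa : φ (φ a) = a := by
    have := congrArg φ e1
    rw [map_mul, map_one] at this
    have hne : φ a ≠ 0 := by intro h; rw [h] at e1; simp at e1
    apply mul_right_cancel₀ hne
    rw [this, mul_comm, e1]
  have hφφb : φ (φ b) = b := by
    have := congrArg φ e2
    rw [map_mul, map_one] at this
    have hne : φ b ≠ 0 := by intro h; rw [h] at e2; simp at e2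
    apply mul_right_cancel₀ hne
    rw [this, mul_comm, e2]
  have hanti : φ (c1 * c2 * (a * φ b - b * φ a)) = -(c1 * c2 * (a * φ b - b * φ a)) := by
    simp only [map_mul, map_sub, f1, f2, hφφa, hφφb]
    ring
  have hzero : (2 : F) * z = 0 := by
    rcases sq_eq_sq_iff_eq_or_eq_neg.1 hsq with h | h
    · rw [h, hzφ] at hanti
      linear_combination hanti
    · rw [h, map_neg, hzφ] at hanti
      linear_combination (-1) * hanti
  exact hz0 (Subtype.ext ((mul_eq_zero.1 hzero).resolve_left h2))

end CovRad

/-- Standard setup with `q0 ≡ 7 (mod 8)` and `m = (q0−1)/2`. If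
`q0^s + 1 − 2(1 + 2^(m−1)(m−2))·√(q0^s) > 2^m` (in ℝ), then the covering
radius of `C_s(q0)` is `3`: every `μ ∈ F` is a sum of three elements `c·h`,
and some `μ ∈ F` is not a sum of two. -/
theorem covering_radius_eq_three_of_large_s (q0 s q m : ℕ) (hq0 : IsPrimePow q0)
    (hq0odd : Odd q0) (hq07 : q0 % 8 = 7) (hs : Odd s) (hq : q = q0 ^ s)
    (hm : m = (q0 - 1) / 2)
    (hineq : (q0 : ℝ) ^ s + 1 -
        2 * (1 + 2 ^ (m - 1) * ((m : ℝ) - 2)) * Real.sqrt ((q0 : ℝ) ^ s) >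
      2 ^ m)
    (F : Type*) [Field F] [Fintype F] (hF : Fintype.card F = q ^ 2)
    (K : Subfield F) (hK : Nat.card K = q0)
    (H : Subgroup Fˣ) (hH : Nat.card H = q + 1) :
    (∀ μ : F, ∃ c1 c2 c3 : F, c1 ∈ K ∧ c2 ∈ K ∧ c3 ∈ K ∧
        ∃ h1 h2 h3 : Fˣ, h1 ∈ H ∧ h2 ∈ H ∧ h3 ∈ H ∧
          μ = c1 * (h1 : F) + c2 * (h2 : F) + c3 * (h3 : F)) ∧
      (∃ μ : F, ∀ c1 c2 : F, c1 ∈ K → c2 ∈ K →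
        ∀ h1 h2 : Fˣ, h1 ∈ H → h2 ∈ H → μ ≠ c1 * (h1 : F) + c2 * (h2 : F)) := by
  classical
  obtain ⟨p, j, hp, hj, hpj⟩ := (isPrimePow_nat_iff q0).1 hq0
  haveI : Fact p.Prime := ⟨hp⟩
  have hqp : q = p ^ (j * s) := by rw [hq, ← hpj, pow_mul]
  haveI : CharP F p := charP_of_card_eq_prime_pow (f := j * s * 2) (by rw [hF, hqp, ← pow_mul])
  have hs1 : 1 ≤ s := hs.pos
  have hq0q : q0 ≤ q := by rw [hq]; exact Nat.le_self_pow (by omega) _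
  have hqodd : Odd q := by rw [hq]; exact hq0odd.pow
  obtain ⟨k, hk⟩ := hqodd
  let φ : F →+* F := iterateFrobenius F p (j * s)
  have hφ : ∀ x, φ x = x ^ q := fun x => by rw [hqp]; exact iterateFrobenius_def ..
  have hφφ : ∀ x, φ (φ x) = x := by
    intro x
    rw [hφ, hφ, ← pow_mul, ← sq, ← hF, FiniteField.pow_card]
  have h2 : (2 : F) ≠ 0 := by
    apply Ring.two_ne_zero
    apply CovRad.ringChar_ne_two (2 * k ^ 2 + 2 * k)
    rw [hF, hk]; ring
  let L : Subfield F := RingHom.eqLocusField φ (RingHom.id F)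
  have hL : ∀ x, x ∈ L ↔ φ x = x := fun x => Iff.rfl
  obtain ⟨hmem, hnorm, hcard⟩ := CovRad.norm_facts q (by omega) hF H hH
  have hLc : Nat.card L = q := by
    rw [← hcard, ← Fintype.card_subtype, ← Nat.card_eq_fintype_card]
    apply Nat.card_congr
    exact Equiv.subtypeEquivRight fun x => by
      rw [← hφ]; exact hL x
  have hKL : K ≤ L := by
    intro x hx
    rw [hL, hφ, hq]
    haveI : Fintype K := Fintype.ofFinite _
    have h1 : x ^ q0 = x := by
      have := FiniteField.pow_card (⟨x, hx⟩ : K)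
      rw [← Nat.card_eq_fintype_card, hK] at this
      exact congrArg Subtype.val this
    have h3 : ∀ t, x ^ q0 ^ t = x := by
      intro t
      induction t with
      | zero => simp
      | succ t ih => rw [pow_succ, pow_mul, ih, h1]
    exact h3 s
  refine ⟨fun μ => CovRad.part_one q k hk φ hφ hφφ h2 L hL hLc H hH hmem hnorm K μ, ?_⟩
  obtain ⟨B, hBc, hB⟩ := CovRad.squares_finset K L hKL m q0 (by omega) (by omega) hK
  haveI : Fintype L := Fintype.ofFinite _
  have hLc' : Fintype.card L = q := by rw [← Nat.card_eq_fintype_card, hLc]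
  set Q := Real.sqrt ((q0 : ℝ) ^ s) with hQdef
  have hqR : (q0 : ℝ) ^ s = q := by rw [hq]; push_cast; rfl
  have hQ2 : Q ^ 2 = q := by
    rw [hQdef, Real.sq_sqrt (by positivity), hqR]
  have hQpos : 0 < Q := by
    apply Real.sqrt_pos.2
    have : (0 : ℝ) < q0 := by exact_mod_cast (show 0 < q0 by omega)
    positivity
  have h2m : (2 : ℝ) ^ m = 2 * 2 ^ (m - 1) := by
    rw [← pow_succ']; congr 1; omega
  have h2m1 : (1 : ℝ) ≤ 2 ^ m := one_le_pow₀ (by norm_num)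
  have hQ1 : 2 ^ m * ((m : ℝ) - 2) + 2 ≤ Q := by
    by_contra hcon
    push Not at hcon
    rw [hqR, ← hQ2] at hineq
    have e1 : 2 * (1 + 2 ^ (m - 1) * ((m : ℝ) - 2)) = 2 ^ m * ((m : ℝ) - 2) + 2 := by
      rw [h2m]; ring
    rw [e1] at hineq
    have := mul_lt_mul_of_pos_right hcon hQpos
    linarith
  have hex : ∃ n : L, (∀ b ∈ B, quadraticChar L (n - b) = 1) ∨
      (∀ b ∈ B, quadraticChar L (n - b) = -1) := by
    by_cases h7 : q0 = 7
    · have hm3 : m = 3 := by omega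
      subst hm3
      apply CovRad.exists_four k (hLc'.trans hk) _ B hBc
      rw [hLc']
      have hs3 : s ≠ 1 := by
        rintro rfl
        rw [h7] at hq
        norm_num at hQ1
        have : (q : ℝ) = 7 := by rw [hq]; norm_num
        nlinarith
      have : 3 ≤ s := by
        obtain ⟨t, rfl⟩ := hs
        omega
      rw [hq, h7]
      calc 343 = 7 ^ 3 := by norm_num
        _ ≤ 7 ^ s := Nat.pow_le_pow_right (by norm_num) this
    · have h15 : q0 ≠ 15 := by
        rintro rfl
        have h3 : p = 3 := by
          have : (3 : ℕ) ∣ p ^ j := by rw [hpj]; norm_num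
          exact ((Nat.prime_dvd_prime_iff_eq Nat.prime_three hp).1
            (Nat.prime_three.dvd_of_dvd_pow this)).symm
        have h5 : p = 5 := by
          have : (5 : ℕ) ∣ p ^ j := by rw [hpj]; norm_num
          exact ((Nat.prime_dvd_prime_iff_eq Nat.prime_five hp).1
            (Nat.prime_five.dvd_of_dvd_pow this)).symm
        omega
      have hm11 : 11 ≤ m := by omega
      have hmodd : Odd m := by rw [Nat.odd_iff]; omega
      exact CovRad.exists_large k m (hLc'.trans hk) hmodd hm11 B hBc Q (by rw [hLc', hQ2]) hQ1
  obtain ⟨n, hn⟩ := hex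
  exact CovRad.part_two q φ hφ h2 L hL H hmem hnorm K hKL B hB n hn
end
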